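/- arXiv:2502.18976 — 12 statements merged into one kernel-verified Lean document; each statement's English description precedes it below -/
import Mathlib

section
/- Let p ≥ 3 be a prime. Let f, g : ℤ_p² → ℤ_p² be maps such that each component of f(x) − x and of g(x) − x is given, for all x ∈ ℤ_p², by an everywhere-convergent power series Σ_I c_I x^I whose coefficients c_I all lie in pℤ_p and satisfy |c_I|_p → 0 as |I| → ∞. Suppose x₀ ∈ ℤ_p² is a point such that the determinant of the 2×2 matrix with columns (f(x₀)−x₀)/p and (g(x₀)−x₀)/p is a unit of ℤ_p. Then f and g are bijections of ℤ_p², the polydisk x₀ + (pℤ_p)² is invariant under f, g, f⁻¹ and g⁻¹, and for every x₁ ∈ x₀ + (pℤ_p)², the orbit of x₁ under the group of bijections generated by f and g is dense in x₀ + (pℤ_p)². -/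
open Polynomial

noncomputable section

/-- The companion matrix `C(x) = [[x, -1], [1, 0]]`. -/
def cmat {R : Type*} [CommRing R] (x : R) : Matrix (Fin 2) (Fin 2) R := !![x, -1; 1, 0]

def chebTAux : ℕ → Polynomial ℤ
  | 0 => 2
  | 1 => X
  | n + 2 => X * chebTAux (n + 1) - chebTAux n

def chebUAux : ℕ → Polynomial ℤ
  | 0 => 1
  | 1 => X
  | n + 2 => X * chebUAux (n + 1) - chebUAux n

/-- The monic Chebyshev polynomial of the first kind `T_n` (`n ∈ ℤ`), defined by the
recurrence `T_n = X T_{n-1} - T_{n-2}` with `T_{-1} = X`, `T_0 = 2`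
(using the symmetry `T_{-n} = T_n`). -/
def chebT (n : ℤ) : Polynomial ℤ := chebTAux n.natAbs

/-- The monic Chebyshev polynomial of the second kind `U_n` (`n ∈ ℤ`), defined by the
recurrence `U_n = X U_{n-1} - U_{n-2}` with `U_{-1} = 0`, `U_0 = 1`
(using the symmetry `U_{-n-2} = -U_n`). -/
def chebU (n : ℤ) : Polynomial ℤ :=
  if 0 ≤ n then chebUAux n.toNat
  else if n = -1 then 0
  else -chebUAux (-(n + 2)).toNat

/-- The Vieta involution `s_x : (x, y, z) ↦ (yz - x, y, z)`. -/
def vietaSx (R : Type*) [CommRing R] : Equiv.Perm (R × R × R) :=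
  Function.Involutive.toPerm (fun v => (v.2.1 * v.2.2 - v.1, v.2.1, v.2.2)) (by
    rintro ⟨x, y, z⟩; simp)

/-- The Vieta involution `s_y : (x, y, z) ↦ (x, xz - y, z)`. -/
def vietaSy (R : Type*) [CommRing R] : Equiv.Perm (R × R × R) :=
  Function.Involutive.toPerm (fun v => (v.1, v.1 * v.2.2 - v.2.1, v.2.2)) (by
    rintro ⟨x, y, z⟩; simp)

/-- The Vieta involution `s_z : (x, y, z) ↦ (x, y, xy - z)`. -/
def vietaSz (R : Type*) [CommRing R] : Equiv.Perm (R × R × R) :=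
  Function.Involutive.toPerm (fun v => (v.1, v.2.1, v.1 * v.2.1 - v.2.2)) (by
    rintro ⟨x, y, z⟩; simp)

/-- The double sign change `(x, y, z) ↦ (x, -y, -z)`. -/
def signYZ (R : Type*) [CommRing R] : Equiv.Perm (R × R × R) :=
  Function.Involutive.toPerm (fun v => (v.1, -v.2.1, -v.2.2)) (by
    rintro ⟨x, y, z⟩; simp)

/-- The double sign change `(x, y, z) ↦ (-x, y, -z)`. -/
def signXZ (R : Type*) [CommRing R] : Equiv.Perm (R × R × R) :=
  Function.Involutive.toPerm (fun v => (-v.1, v.2.1, -v.2.2)) (by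
    rintro ⟨x, y, z⟩; simp)

/-- The double sign change `(x, y, z) ↦ (-x, -y, z)`. -/
def signXY (R : Type*) [CommRing R] : Equiv.Perm (R × R × R) :=
  Function.Involutive.toPerm (fun v => (-v.1, -v.2.1, v.2.2)) (by
    rintro ⟨x, y, z⟩; simp)

/-- The coordinate transposition `(x, y, z) ↦ (y, x, z)`. -/
def swapXY (R : Type*) [CommRing R] : Equiv.Perm (R × R × R) :=
  Function.Involutive.toPerm (fun v => (v.2.1, v.1, v.2.2)) (by
    rintro ⟨x, y, z⟩; simp)

/-- The coordinate transposition `(x, y, z) ↦ (x, z, y)`. -/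
def swapYZ (R : Type*) [CommRing R] : Equiv.Perm (R × R × R) :=
  Function.Involutive.toPerm (fun v => (v.1, v.2.2, v.2.1)) (by
    rintro ⟨x, y, z⟩; simp)

/-- The coordinate transposition `(x, y, z) ↦ (z, y, x)`. -/
def swapXZ (R : Type*) [CommRing R] : Equiv.Perm (R × R × R) :=
  Function.Involutive.toPerm (fun v => (v.2.2, v.2.1, v.1)) (by
    rintro ⟨x, y, z⟩; simp)

/-- The nonsingular locus `X_D^*(R)` of the Markoff surface
`x² + y² + z² - xyz = D`: points where one of `2x - yz`, `2y - xz`, `2z - xy` is a unit. -/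
def markoffSet (R : Type*) [CommRing R] (D : R) : Set (R × R × R) :=
  {v | v.1 ^ 2 + v.2.1 ^ 2 + v.2.2 ^ 2 - v.1 * v.2.1 * v.2.2 = D ∧
    (IsUnit (2 * v.1 - v.2.1 * v.2.2) ∨ IsUnit (2 * v.2.1 - v.1 * v.2.2) ∨
      IsUnit (2 * v.2.2 - v.1 * v.2.1))}

/-- The group `Γ` generated by the three Vieta involutions. -/
def vietaGroup (R : Type*) [CommRing R] : Subgroup (Equiv.Perm (R × R × R)) :=
  Subgroup.closure {vietaSx R, vietaSy R, vietaSz R}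

/-- The group generated by the Vieta involutions, double sign changes and all
permutations of the coordinates (the transpositions generate all permutations). -/
def fullAutGroup (R : Type*) [CommRing R] : Subgroup (Equiv.Perm (R × R × R)) :=
  Subgroup.closure {vietaSx R, vietaSy R, vietaSz R, signYZ R, signXZ R, signXY R,
    swapXY R, swapYZ R, swapXZ R}

/-- A function `ℤ_p² → ℤ_p` given by an everywhere-convergent power series
`Σ_I c_I x^I` whose coefficients all lie in `pℤ_p` and tend to `0` as `|I| → ∞`. -/
def PadicAnalyticSmall (p : ℕ) [Fact p.Prime] (F : ℤ_[p] × ℤ_[p] → ℤ_[p]) : Prop :=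
  ∃ c : ℕ × ℕ → ℤ_[p],
    (∀ I, ‖c I‖ ≤ ((p : ℝ))⁻¹) ∧
    Filter.Tendsto (fun I => ‖c I‖) Filter.cofinite (nhds 0) ∧
    ∀ x : ℤ_[p] × ℤ_[p], HasSum (fun I : ℕ × ℕ => c I * x.1 ^ I.1 * x.2 ^ I.2) (F x)

/-- The polydisk `x₀ + (pℤ_p)²`. -/
def pDisk (p : ℕ) [Fact p.Prime] (x₀ : ℤ_[p] × ℤ_[p]) : Set (ℤ_[p] × ℤ_[p]) :=
  {x | ‖x.1 - x₀.1‖ ≤ ((p : ℝ))⁻¹ ∧ ‖x.2 - x₀.2‖ ≤ ((p : ℝ))⁻¹}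

theorem Nat.Prime.pow_dvd_pow_mul_choose {p : ℕ} (hpp : p.Prime) (hp : 3 ≤ p)
    {k n j : ℕ} (hn : p ^ k ∣ n) (hj : 2 ≤ j) :
    p ^ (k + 2) ∣ p ^ j * n.choose j := by
  obtain ⟨i, rfl⟩ : ∃ i, j = i + 1 := ⟨j - 1, by omega⟩
  rcases n with _ | n
  · simp
  have hmul : p ^ k ∣ (n + 1).choose (i + 1) * (i + 1) := by
    rw [← Nat.add_one_mul_choose_eq]
    exact hn.mul_right _
  obtain ⟨e, m, hm, hem⟩ := Nat.exists_eq_pow_mul_and_not_dvd (Nat.succ_ne_zero i) p hpp.ne_one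
  have he : e + 2 ≤ i + 1 := by
    rcases e with _ | e
    · omega
    have h1 : e + 3 ≤ 3 ^ (e + 1) := by
      clear * -
      induction e with
      | zero => norm_num
      | succ e ih => rw [pow_succ]; omega
    have h2 : 3 ^ (e + 1) ≤ p ^ (e + 1) := Nat.pow_le_pow_left hp _
    have h3 : p ^ (e + 1) ≤ i + 1 := Nat.le_of_dvd (by omega) ⟨m, hem⟩
    omega
  have hdvd : p ^ k ∣ p ^ e * (n + 1).choose (i + 1) := by
    have hcop : Nat.Coprime (p ^ k) m := ((Nat.Prime.coprime_iff_not_dvd hpp).2 hm).pow_left k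
    refine hcop.dvd_of_dvd_mul_right ?_
    rw [Nat.succ_eq_add_one] at hem
    convert hmul using 1
    rw [mul_right_comm, ← hem, mul_comm]
  obtain ⟨r, hr⟩ := Nat.exists_eq_add_of_le he
  calc p ^ (k + 2) = p ^ 2 * p ^ k := by ring
    _ ∣ p ^ 2 * (p ^ e * (n + 1).choose (i + 1)) := mul_dvd_mul_left _ hdvd
    _ ∣ p ^ (i + 1) * (n + 1).choose (i + 1) := ⟨p ^ r, by rw [hr]; ring⟩

section PadicDynamics

variable {p : ℕ} [Fact p.Prime]

theorem PadicInt.pow_dvd_iff_norm_le (x : ℤ_[p]) (n : ℕ) :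
    (p : ℤ_[p]) ^ n ∣ x ↔ ‖x‖ ≤ (p : ℝ) ^ (-n : ℤ) := by
  rw [PadicInt.norm_le_pow_iff_mem_span_pow, Ideal.mem_span_singleton]

theorem PadicInt.dvd_iff_norm_le_inv (x : ℤ_[p]) :
    (p : ℤ_[p]) ∣ x ↔ ‖x‖ ≤ (p : ℝ)⁻¹ := by
  simpa using PadicInt.pow_dvd_iff_norm_le x 1

theorem PadicInt.exists_pow_dvd_imp_norm_lt {ε : ℝ} (hε : 0 < ε) :
    ∃ N : ℕ, ∀ x : ℤ_[p], (p : ℤ_[p]) ^ N ∣ x → ‖x‖ < ε := by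
  obtain ⟨N, hN⟩ := PadicInt.exists_pow_neg_lt p hε
  exact ⟨N, fun x hx => ((PadicInt.pow_dvd_iff_norm_le x N).1 hx).trans_lt hN⟩

theorem PadicInt.natCast_prime_ne_zero : (p : ℤ_[p]) ≠ 0 :=
  Nat.cast_ne_zero.2 (Fact.out : p.Prime).ne_zero

/-- Polynomial functions `ℤ_p² → ℤ_p`. -/
def polyFun (p : ℕ) [Fact p.Prime] : Subalgebra ℤ_[p] (ℤ_[p] × ℤ_[p] → ℤ_[p]) :=
  Algebra.adjoin ℤ_[p] {Prod.fst, Prod.snd}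

/-- Uniform limits of polynomial functions `ℤ_p² → ℤ_p`. -/
def tateFun (p : ℕ) [Fact p.Prime] : Subalgebra ℤ_[p] (ℤ_[p] × ℤ_[p] → ℤ_[p]) where
  carrier := {h | ∀ N : ℕ, ∃ P ∈ polyFun p, ∀ x, (p : ℤ_[p]) ^ N ∣ h x - P x}
  mul_mem' := by
    intro a b ha hb N
    obtain ⟨P, hP, hPa⟩ := ha N
    obtain ⟨Q, hQ, hQb⟩ := hb N
    refine ⟨P * Q, mul_mem hP hQ, fun x => ?_⟩
    have : (a * b) x - (P * Q) x = a x * (b x - Q x) + (a x - P x) * Q x := by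
      simp only [Pi.mul_apply]; ring
    rw [this]
    exact dvd_add ((hQb x).mul_left _) ((hPa x).mul_right _)
  add_mem' := by
    intro a b ha hb N
    obtain ⟨P, hP, hPa⟩ := ha N
    obtain ⟨Q, hQ, hQb⟩ := hb N
    refine ⟨P + Q, add_mem hP hQ, fun x => ?_⟩
    have : (a + b) x - (P + Q) x = (a x - P x) + (b x - Q x) := by
      simp only [Pi.add_apply]; ring
    rw [this]
    exact dvd_add (hPa x) (hQb x)
  algebraMap_mem' := fun r _ => ⟨_, (polyFun p).algebraMap_mem r, fun x => by simp⟩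

theorem mem_tateFun {h : ℤ_[p] × ℤ_[p] → ℤ_[p]} :
    h ∈ tateFun p ↔ ∀ N : ℕ, ∃ P ∈ polyFun p, ∀ x, (p : ℤ_[p]) ^ N ∣ h x - P x := Iff.rfl

theorem polyFun_le_tateFun : polyFun p ≤ tateFun p := fun P hP _ => ⟨P, hP, by simp⟩

theorem fst_mem_polyFun : (Prod.fst : ℤ_[p] × ℤ_[p] → ℤ_[p]) ∈ polyFun p :=
  Algebra.subset_adjoin (by simp)

theorem snd_mem_polyFun : (Prod.snd : ℤ_[p] × ℤ_[p] → ℤ_[p]) ∈ polyFun p :=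
  Algebra.subset_adjoin (by simp)

/-- A function which is, modulo every `p ^ (N + 1)`, equal to `p` times a polynomial function,
is `p` times a uniform limit of polynomial functions. -/
theorem exists_tateFun_of_approx {h : ℤ_[p] × ℤ_[p] → ℤ_[p]}
    (H : ∀ N : ℕ, ∃ P ∈ polyFun p, ∀ x, (p : ℤ_[p]) ^ (N + 1) ∣ h x - p * P x) :
    ∃ k ∈ tateFun p, ∀ x, h x = p * k x := by
  have hdvd : ∀ x, (p : ℤ_[p]) ∣ h x := fun x => by
    obtain ⟨P, -, hP⟩ := H 0
    have := dvd_add (hP x) (by simp : (p : ℤ_[p]) ^ (0 + 1) ∣ p * P x)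
    simpa using this
  choose k hk using hdvd
  refine ⟨k, fun N => ?_, hk⟩
  obtain ⟨P, hPm, hP⟩ := H N
  refine ⟨P, hPm, fun x => ?_⟩
  have := hP x
  rw [hk, ← mul_sub, pow_succ'] at this
  exact (mul_dvd_mul_iff_left PadicInt.natCast_prime_ne_zero).1 this

theorem PadicAnalyticSmall.exists_tateFun {h : ℤ_[p] × ℤ_[p] → ℤ_[p]}
    (hh : PadicAnalyticSmall p h) : ∃ k ∈ tateFun p, ∀ x, h x = p * k x := by
  obtain ⟨c, hc, hc0, hsum⟩ := hh
  choose d hd using fun I => (PadicInt.dvd_iff_norm_le_inv (c I)).2 (hc I)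
  refine exists_tateFun_of_approx fun N => ?_
  set ε : ℝ := (p : ℝ) ^ (-(N + 1 : ℕ) : ℤ) with hε_def
  have hε : 0 < ε := zpow_pos (by exact_mod_cast (Fact.out : p.Prime).pos) _
  have hfin : {I | ¬ ‖c I‖ < ε}.Finite := hc0.eventually (gt_mem_nhds hε)
  refine ⟨∑ I ∈ hfin.toFinset, d I • (Prod.fst ^ I.1 * Prod.snd ^ I.2),
    sum_mem fun I _ => Subalgebra.smul_mem _
      (mul_mem (pow_mem fst_mem_polyFun _) (pow_mem snd_mem_polyFun _)) _, fun x => ?_⟩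
  rw [PadicInt.pow_dvd_iff_norm_le]
  have hS : (p : ℤ_[p]) * (∑ I ∈ hfin.toFinset, d I • (Prod.fst ^ I.1 * Prod.snd ^ I.2) :
      ℤ_[p] × ℤ_[p] → ℤ_[p]) x = ∑ I ∈ hfin.toFinset, c I * x.1 ^ I.1 * x.2 ^ I.2 := by
    simp only [Finset.sum_apply, Finset.mul_sum]
    refine Finset.sum_congr rfl fun I _ => ?_
    simp only [Pi.smul_apply, Pi.mul_apply, Pi.pow_apply, smul_eq_mul, hd I]
    ring
  rw [hS]
  refine le_of_tendsto ((hsum x).sub_const _).norm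
    ((Filter.eventually_ge_atTop hfin.toFinset).mono fun T hT => ?_)
  rw [← Finset.sum_sdiff hT, add_sub_cancel_right]
  refine IsUltrametricDist.norm_sum_le_of_forall_le_of_nonneg hε.le fun I hI => ?_
  have hI' : ‖c I‖ < ε := by simpa using (Finset.mem_sdiff.1 hI).2
  rw [mul_assoc, norm_mul]
  exact (mul_le_of_le_one_right (norm_nonneg _) (PadicInt.norm_le_one _)).trans hI'.le

theorem tateFun_norm_sub_le {h : ℤ_[p] × ℤ_[p] → ℤ_[p]} (hh : h ∈ tateFun p)
    (x y : ℤ_[p] × ℤ_[p]) : ‖h x - h y‖ ≤ ‖x - y‖ := by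
  have hpoly : ∀ P ∈ polyFun p, ‖P x - P y‖ ≤ ‖x - y‖ := by
    intro P hP
    induction hP using Algebra.adjoin_induction with
    | mem P hP =>
      rcases hP with rfl | rfl
      · exact norm_fst_le (x - y)
      · exact norm_snd_le (x - y)
    | algebraMap r => simp
    | add a b _ _ ha hb =>
      have : (a + b) x - (a + b) y = (a x - a y) + (b x - b y) := by
        simp only [Pi.add_apply]; ring
      rw [this]
      exact (PadicInt.nonarchimedean _ _).trans (max_le ha hb)
    | mul a b _ _ ha hb =>
      have : (a * b) x - (a * b) y = a x * (b x - b y) + (a x - a y) * b y := by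
        simp only [Pi.mul_apply]; ring
      rw [this]
      refine (PadicInt.nonarchimedean _ _).trans (max_le ?_ ?_) <;> rw [norm_mul]
      · exact (mul_le_of_le_one_left (norm_nonneg _) (PadicInt.norm_le_one _)).trans hb
      · exact (mul_le_of_le_one_right (norm_nonneg _) (PadicInt.norm_le_one _)).trans ha
  rcases eq_or_ne x y with rfl | hxy
  · simp
  obtain ⟨N, hN⟩ :=
    PadicInt.exists_pow_dvd_imp_norm_lt (p := p) (norm_pos_iff.2 (sub_ne_zero.2 hxy))
  obtain ⟨P, hPm, hP⟩ := hh N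
  have : h x - h y = (h x - P x) + (P x - P y) + -(h y - P y) := by ring
  rw [this]
  refine (PadicInt.nonarchimedean _ _).trans (max_le ((PadicInt.nonarchimedean _ _).trans
    (max_le (hN _ (hP x)).le (hpoly P hPm))) ?_)
  rw [norm_neg]
  exact (hN _ (hP y)).le

theorem tateFun_pow_dvd_sub {h : ℤ_[p] × ℤ_[p] → ℤ_[p]} (hh : h ∈ tateFun p) {n : ℕ}
    {x y : ℤ_[p] × ℤ_[p]} (h₁ : (p : ℤ_[p]) ^ n ∣ x.1 - y.1) (h₂ : (p : ℤ_[p]) ^ n ∣ x.2 - y.2) :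
    (p : ℤ_[p]) ^ n ∣ h x - h y := by
  rw [PadicInt.pow_dvd_iff_norm_le] at *
  exact (tateFun_norm_sub_le hh x y).trans (norm_prod_le_iff.2 ⟨h₁, h₂⟩)

/-- A self-map of `ℤ_p²` differing from the identity by `p` times a uniform limit of polynomial
maps. -/
def IsTateNearId (p : ℕ) [Fact p.Prime] (f : ℤ_[p] × ℤ_[p] → ℤ_[p] × ℤ_[p])
    (F₁ F₂ : ℤ_[p] × ℤ_[p] → ℤ_[p]) : Prop :=
  F₁ ∈ tateFun p ∧ F₂ ∈ tateFun p ∧ ∀ x, f x = (x.1 + p * F₁ x, x.2 + p * F₂ x)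

namespace IsTateNearId

variable {f : ℤ_[p] × ℤ_[p] → ℤ_[p] × ℤ_[p]} {F₁ F₂ : ℤ_[p] × ℤ_[p] → ℤ_[p]}

theorem exists_comp_sub (hf : IsTateNearId p f F₁ F₂) {h : ℤ_[p] × ℤ_[p] → ℤ_[p]}
    (hh : h ∈ tateFun p) : ∃ k ∈ tateFun p, ∀ x, h (f x) - h x = p * k x := by
  obtain ⟨hF₁, hF₂, hfx⟩ := hf
  have hpoly : ∀ P ∈ polyFun p, ∃ k ∈ tateFun p, ∀ x, P (f x) - P x = p * k x := by
    intro P hP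
    induction hP using Algebra.adjoin_induction with
    | mem P hP =>
      rcases hP with rfl | rfl
      · exact ⟨F₁, hF₁, fun x => by simp [hfx]⟩
      · exact ⟨F₂, hF₂, fun x => by simp [hfx]⟩
    | algebraMap r => exact ⟨0, zero_mem _, fun x => by simp⟩
    | add a b _ _ ha hb =>
      obtain ⟨k, hk, hk'⟩ := ha
      obtain ⟨l, hl, hl'⟩ := hb
      refine ⟨k + l, add_mem hk hl, fun x => ?_⟩
      simp only [Pi.add_apply]
      linear_combination hk' x + hl' x
    | mul a b ham hbm ha hb =>
      obtain ⟨k, hk, hk'⟩ := ha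
      obtain ⟨l, hl, hl'⟩ := hb
      refine ⟨k * b + a * l + (p : ℤ_[p]) • (k * l), add_mem (add_mem
        (mul_mem hk (polyFun_le_tateFun hbm)) (mul_mem (polyFun_le_tateFun ham) hl))
        (Subalgebra.smul_mem _ (mul_mem hk hl) _), fun x => ?_⟩
      simp only [Pi.add_apply, Pi.mul_apply, Pi.smul_apply, smul_eq_mul]
      linear_combination b (f x) * hk' x + (a x) * hl' x + p * k x * hl' x
  refine exists_tateFun_of_approx fun N => ?_
  obtain ⟨P, hPm, hP⟩ := hh (N + 1)
  obtain ⟨k, hkm, hk⟩ := hpoly P hPm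
  obtain ⟨Q, hQm, hQ⟩ := hkm N
  refine ⟨Q, hQm, fun x => ?_⟩
  have : h (f x) - h x - p * Q x =
      (h (f x) - P (f x)) - (h x - P x) + p * (k x - Q x) := by
    linear_combination hk x
  rw [this]
  refine dvd_add (dvd_sub (hP _) (hP _)) ?_
  rw [pow_succ']
  exact mul_dvd_mul_left _ (hQ x)

/-- To first order, the `n`-th iterate adds `n` times the displacement: the error is divisible by
`p ^ (k + 2)` when `p ^ k ∣ n`. -/
theorem iterate_comp_sub_dvd (hf : IsTateNearId p f F₁ F₂) (hp : 3 ≤ p)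
    {h : ℤ_[p] × ℤ_[p] → ℤ_[p]} (hh : h ∈ tateFun p) {k n : ℕ} (hn : p ^ k ∣ n)
    (x : ℤ_[p] × ℤ_[p]) :
    (p : ℤ_[p]) ^ (k + 2) ∣ h (f^[n] x) - h x - n * (h (f x) - h x) := by
  choose D hDm hD using fun a : tateFun p => hf.exists_comp_sub a.2
  let H : ℕ → tateFun p := fun j => (fun a => ⟨D a, hDm a⟩)^[j] ⟨h, hh⟩
  have hH : ∀ j y, (H j : ℤ_[p] × ℤ_[p] → ℤ_[p]) (f y) - (H j).1 y = p * (H (j + 1)).1 y := by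
    intro j y
    simp only [H, Function.iterate_succ_apply']
    exact hD _ y
  have hdiff : ∀ j, (fwdDiff 1)^[j] (fun m : ℕ => h (f^[m] x)) =
      fun m => (p : ℤ_[p]) ^ j * (H j).1 (f^[m] x) := by
    intro j
    induction j with
    | zero => funext m; simp [H]
    | succ j ih =>
      rw [Function.iterate_succ_apply', ih]
      funext m
      rw [fwdDiff, Function.iterate_succ_apply', ← mul_sub, hH]
      ring
  rcases n with _ | n
  · simp
  have hsum := shift_eq_sum_fwdDiff_iter 1 (fun m : ℕ => h (f^[m] x)) (n + 1) 0
  simp only [hdiff, Finset.sum_range_succ' _ (n + 1), Finset.sum_range_succ' _ n] at hsum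
  have h0 : (H 0).1 = h := rfl
  have h1 := hH 0 x
  rw [h0, zero_add] at h1
  simp [h0] at hsum
  rw [← Function.iterate_succ_apply] at hsum
  rw [hsum, h1]
  have : ∀ a b c : ℤ_[p], a + b + c - c - b = a := fun a b c => by ring
  push_cast
  rw [this]
  refine Finset.dvd_sum fun i _ => ?_
  rw [← mul_assoc]
  refine Dvd.dvd.mul_right ?_ _
  have := Nat.Prime.pow_dvd_pow_mul_choose Fact.out hp hn (show 2 ≤ i + 1 + 1 by omega)
  rw [mul_comm]
  exact_mod_cast Nat.cast_dvd_cast (α := ℤ_[p]) this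

theorem bijective (hf : IsTateNearId p f F₁ F₂) : Function.Bijective f := by
  obtain ⟨hF₁, hF₂, hfx⟩ := hf
  have hpp : p.Prime := Fact.out
  have hK : ∀ y : ℤ_[p] × ℤ_[p], ContractingWith (p : NNReal)⁻¹
      (fun x : ℤ_[p] × ℤ_[p] => (y.1 - p * F₁ x, y.2 - p * F₂ x)) := by
    refine fun y => ⟨inv_lt_one_of_one_lt₀ (by exact_mod_cast hpp.one_lt),
      LipschitzWith.of_dist_le_mul fun a b => ?_⟩
    rw [dist_eq_norm, dist_eq_norm, norm_prod_le_iff]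
    have key : ∀ F ∈ tateFun p, ∀ c : ℤ_[p],
        ‖(c - p * F a) - (c - p * F b)‖ ≤ (p : ℝ)⁻¹ * ‖a - b‖ := by
      intro F hF c
      have : (c - p * F a) - (c - p * F b) = -(p * (F a - F b)) := by ring
      rw [this, norm_neg, norm_mul, PadicInt.norm_p]
      gcongr
      exact tateFun_norm_sub_le hF a b
    exact ⟨by simpa using key F₁ hF₁ y.1, by simpa using key F₂ hF₂ y.2⟩
  have hfix : ∀ x y, f x = y ↔
      Function.IsFixedPt (fun x : ℤ_[p] × ℤ_[p] => (y.1 - p * F₁ x, y.2 - p * F₂ x)) x := by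
    intro x y
    simp only [Function.IsFixedPt, hfx, Prod.ext_iff, sub_eq_iff_eq_add]
    exact and_congr eq_comm eq_comm
  refine ⟨fun a b hab => ?_, fun y => ⟨_, (hfix _ y).2 (hK y).fixedPoint_isFixedPt⟩⟩
  exact ((hK (f b)).fixedPoint_unique ((hfix a _).1 hab)).trans
    ((hK (f b)).fixedPoint_unique ((hfix b _).1 rfl)).symm

end IsTateNearId

theorem mem_pDisk_iff {x x₀ : ℤ_[p] × ℤ_[p]} :
    x ∈ pDisk p x₀ ↔ (p : ℤ_[p]) ∣ x.1 - x₀.1 ∧ (p : ℤ_[p]) ∣ x.2 - x₀.2 := by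
  simp only [PadicInt.dvd_iff_norm_le_inv]; rfl

theorem IsTateNearId.mem_pDisk_iff {f : ℤ_[p] × ℤ_[p] → ℤ_[p] × ℤ_[p]}
    {F₁ F₂ : ℤ_[p] × ℤ_[p] → ℤ_[p]} (hf : IsTateNearId p f F₁ F₂) {x x₀ : ℤ_[p] × ℤ_[p]} :
    f x ∈ pDisk p x₀ ↔ x ∈ pDisk p x₀ := by
  simp only [_root_.mem_pDisk_iff, hf.2.2, add_sub_right_comm, dvd_add_left (dvd_mul_right _ _)]

theorem IsTateNearId.iterate_mem_pDisk {f : ℤ_[p] × ℤ_[p] → ℤ_[p] × ℤ_[p]}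
    {F₁ F₂ : ℤ_[p] × ℤ_[p] → ℤ_[p]} (hf : IsTateNearId p f F₁ F₂) {x x₀ : ℤ_[p] × ℤ_[p]}
    (hx : x ∈ pDisk p x₀) (n : ℕ) : f^[n] x ∈ pDisk p x₀ := by
  induction n with
  | zero => exact hx
  | succ n ih =>
    rw [Function.iterate_succ_apply']
    exact hf.mem_pDisk_iff.2 ih

/-- On the disk around `x₀`, the `a p ^ k`-th iterate is translation by
`a p ^ (k + 1) F(x₀)` modulo `p ^ (k + 2)`. -/
theorem IsTateNearId.iterate_sub_dvd {f : ℤ_[p] × ℤ_[p] → ℤ_[p] × ℤ_[p]}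
    {F₁ F₂ : ℤ_[p] × ℤ_[p] → ℤ_[p]} (hf : IsTateNearId p f F₁ F₂) (hp : 3 ≤ p)
    {x x₀ : ℤ_[p] × ℤ_[p]} (hx : x ∈ pDisk p x₀) (k a : ℕ) :
    (p : ℤ_[p]) ^ (k + 2) ∣ (f^[p ^ k * a] x).1 - x.1 - a * p ^ (k + 1) * F₁ x₀ ∧
    (p : ℤ_[p]) ^ (k + 2) ∣ (f^[p ^ k * a] x).2 - x.2 - a * p ^ (k + 1) * F₂ x₀ := by
  rw [_root_.mem_pDisk_iff] at hx
  have aux : ∀ h ∈ tateFun p, ∀ F ∈ tateFun p, h (f x) - h x = p * F x →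
      (p : ℤ_[p]) ^ (k + 2) ∣ h (f^[p ^ k * a] x) - h x - a * p ^ (k + 1) * F x₀ := by
    intro h hh F hF hFx
    have h1 := hf.iterate_comp_sub_dvd hp hh (dvd_mul_right (p ^ k) a) x
    have h2 : (p : ℤ_[p]) ^ 1 ∣ F x - F x₀ :=
      tateFun_pow_dvd_sub hF (by simpa using hx.1) (by simpa using hx.2)
    have h3 := mul_dvd_mul_left ((p : ℤ_[p]) ^ (k + 1)) (h2.mul_left a)
    rw [← pow_add] at h3
    convert dvd_add h1 h3 using 1
    rw [hFx]; push_cast; ring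
  exact ⟨aux _ (polyFun_le_tateFun fst_mem_polyFun) F₁ hf.1 (by simp [hf.2.2]),
    aux _ (polyFun_le_tateFun snd_mem_polyFun) F₂ hf.2.1 (by simp [hf.2.2])⟩

theorem PadicInt.exists_natCast_sub_dvd (x : ℤ_[p]) : ∃ a : ℕ, (p : ℤ_[p]) ∣ x - a :=
  ⟨x.appr 1, by simpa [Ideal.mem_span_singleton] using PadicInt.appr_spec 1 x⟩

/-- Two near-identity maps with independent displacements at `x₀` allow to improve an
approximation inside the disk by one digit. -/
theorem exists_iterate_iterate_sub_dvd {f g : ℤ_[p] × ℤ_[p] → ℤ_[p] × ℤ_[p]}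
    {F₁ F₂ G₁ G₂ : ℤ_[p] × ℤ_[p] → ℤ_[p]} (hf : IsTateNearId p f F₁ F₂)
    (hg : IsTateNearId p g G₁ G₂) (hp : 3 ≤ p) {x y x₀ : ℤ_[p] × ℤ_[p]}
    (hdet : IsUnit (F₁ x₀ * G₂ x₀ - F₂ x₀ * G₁ x₀)) (hx : x ∈ pDisk p x₀) {k : ℕ}
    (h₁ : (p : ℤ_[p]) ^ (k + 1) ∣ y.1 - x.1) (h₂ : (p : ℤ_[p]) ^ (k + 1) ∣ y.2 - x.2) :
    ∃ m n : ℕ, (p : ℤ_[p]) ^ (k + 2) ∣ y.1 - (g^[n] (f^[m] x)).1 ∧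
      (p : ℤ_[p]) ^ (k + 2) ∣ y.2 - (g^[n] (f^[m] x)).2 := by
  obtain ⟨w₁, hw₁⟩ := h₁
  obtain ⟨w₂, hw₂⟩ := h₂
  obtain ⟨d, hd⟩ := hdet.exists_left_inv
  obtain ⟨a, r, ha⟩ := PadicInt.exists_natCast_sub_dvd (d * (w₁ * G₂ x₀ - w₂ * G₁ x₀))
  obtain ⟨b, s, hb⟩ := PadicInt.exists_natCast_sub_dvd (d * (F₁ x₀ * w₂ - F₂ x₀ * w₁))
  have hiter : f^[p ^ k * a] x ∈ pDisk p x₀ :=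
    hf.iterate_mem_pDisk hx _
  obtain ⟨⟨u₁, hu₁⟩, ⟨u₂, hu₂⟩⟩ := hf.iterate_sub_dvd hp hx k a
  obtain ⟨⟨v₁, hv₁⟩, ⟨v₂, hv₂⟩⟩ := hg.iterate_sub_dvd hp hiter k b
  refine ⟨p ^ k * a, p ^ k * b, ⟨r * F₁ x₀ + s * G₁ x₀ - u₁ - v₁, ?_⟩,
    ⟨r * F₂ x₀ + s * G₂ x₀ - u₂ - v₂, ?_⟩⟩
  · linear_combination hw₁ - hu₁ - hv₁ + p ^ (k + 1) * (F₁ x₀ * ha + G₁ x₀ * hb - w₁ * hd)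
  · linear_combination hw₂ - hu₂ - hv₂ + p ^ (k + 1) * (F₂ x₀ * ha + G₂ x₀ * hb - w₂ * hd)

theorem exists_isTateNearId {f : ℤ_[p] × ℤ_[p] → ℤ_[p] × ℤ_[p]}
    (hf₁ : PadicAnalyticSmall p (fun x => (f x).1 - x.1))
    (hf₂ : PadicAnalyticSmall p (fun x => (f x).2 - x.2)) :
    ∃ F₁ F₂, IsTateNearId p f F₁ F₂ := by
  obtain ⟨F₁, hF₁, h₁⟩ := hf₁.exists_tateFun
  obtain ⟨F₂, hF₂, h₂⟩ := hf₂.exists_tateFun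
  refine ⟨F₁, F₂, hF₁, hF₂, fun x => Prod.ext ?_ ?_⟩
  · exact sub_eq_iff_eq_add'.1 (h₁ x)
  · exact sub_eq_iff_eq_add'.1 (h₂ x)

end PadicDynamics

/-- local minimality from two commuting-flow directions.
If `f, g : ℤ_p² → ℤ_p²` differ from the identity by power series with coefficients in
`pℤ_p`, and at `x₀` the vectors `(f(x₀)-x₀)/p` and `(g(x₀)-x₀)/p` have unit determinant,
then `f, g` are bijections leaving the polydisk `x₀ + (pℤ_p)²` invariant (together with
their inverses), and every orbit of `⟨f, g⟩` in the polydisk is dense in it. -/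
theorem stmt1 (p : ℕ) [Fact p.Prime] (hp : 3 ≤ p)
    (f g : ℤ_[p] × ℤ_[p] → ℤ_[p] × ℤ_[p])
    (hf1 : PadicAnalyticSmall p (fun x => (f x).1 - x.1))
    (hf2 : PadicAnalyticSmall p (fun x => (f x).2 - x.2))
    (hg1 : PadicAnalyticSmall p (fun x => (g x).1 - x.1))
    (hg2 : PadicAnalyticSmall p (fun x => (g x).2 - x.2))
    (x₀ : ℤ_[p] × ℤ_[p])
    (hdet : ∃ a b : ℤ_[p] × ℤ_[p],
      f x₀ - x₀ = ((p : ℤ_[p]) * a.1, (p : ℤ_[p]) * a.2) ∧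
      g x₀ - x₀ = ((p : ℤ_[p]) * b.1, (p : ℤ_[p]) * b.2) ∧
      IsUnit (a.1 * b.2 - a.2 * b.1)) :
    ∃ fe ge : Equiv.Perm (ℤ_[p] × ℤ_[p]), ⇑fe = f ∧ ⇑ge = g ∧
      (∀ x ∈ pDisk p x₀, fe x ∈ pDisk p x₀) ∧
      (∀ x ∈ pDisk p x₀, fe.symm x ∈ pDisk p x₀) ∧
      (∀ x ∈ pDisk p x₀, ge x ∈ pDisk p x₀) ∧
      (∀ x ∈ pDisk p x₀, ge.symm x ∈ pDisk p x₀) ∧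
      (∀ x₁ ∈ pDisk p x₀, ∀ y ∈ pDisk p x₀, ∀ ε > (0 : ℝ),
        ∃ γ ∈ Subgroup.closure {fe, ge}, dist (γ x₁) y < ε) := by
  obtain ⟨F₁, F₂, hf⟩ := exists_isTateNearId hf1 hf2
  obtain ⟨G₁, G₂, hg⟩ := exists_isTateNearId hg1 hg2
  obtain ⟨a, b, ha, hb, hu⟩ := hdet
  have hdisp : ∀ c d : ℤ_[p], (p : ℤ_[p]) * c = p * d → c = d := fun _ _ h =>
    mul_left_cancel₀ PadicInt.natCast_prime_ne_zero h
  rw [hf.2.2, Prod.ext_iff] at ha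
  rw [hg.2.2, Prod.ext_iff] at hb
  simp only [Prod.fst_sub, Prod.snd_sub, add_sub_cancel_left] at ha hb
  rw [← hdisp _ _ ha.1, ← hdisp _ _ ha.2, ← hdisp _ _ hb.1, ← hdisp _ _ hb.2] at hu
  refine ⟨Equiv.ofBijective f hf.bijective, Equiv.ofBijective g hg.bijective, rfl, rfl,
    fun x hx => hf.mem_pDisk_iff.2 hx, fun x hx => ?_,
    fun x hx => hg.mem_pDisk_iff.2 hx, fun x hx => ?_, fun x₁ hx₁ y hy ε hε => ?_⟩
  · rw [← hf.mem_pDisk_iff, Equiv.ofBijective_apply_symm_apply f hf.bijective]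
    exact hx
  · rw [← hg.mem_pDisk_iff, Equiv.ofBijective_apply_symm_apply g hg.bijective]
    exact hx
  set fe := Equiv.ofBijective f hf.bijective
  set ge := Equiv.ofBijective g hg.bijective
  have happrox : ∀ k : ℕ, ∃ γ ∈ Subgroup.closure {fe, ge}, γ x₁ ∈ pDisk p x₀ ∧
      (p : ℤ_[p]) ^ (k + 1) ∣ y.1 - (γ x₁).1 ∧ (p : ℤ_[p]) ^ (k + 1) ∣ y.2 - (γ x₁).2 := by
    intro k
    induction k with
    | zero =>
      refine ⟨1, one_mem _, hx₁, ?_⟩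
      rw [mem_pDisk_iff] at hx₁ hy
      have h₁ := dvd_sub hy.1 hx₁.1
      have h₂ := dvd_sub hy.2 hx₁.2
      rw [sub_sub_sub_cancel_right] at h₁ h₂
      simpa using ⟨h₁, h₂⟩
    | succ k ih =>
      obtain ⟨γ, hγ, hmem, h₁, h₂⟩ := ih
      obtain ⟨m, n, hmn⟩ := exists_iterate_iterate_sub_dvd hf hg hp hu hmem h₁ h₂
      have heq : (ge ^ n * fe ^ m * γ) x₁ = g^[n] (f^[m] (γ x₁)) := by
        simp only [Equiv.Perm.mul_apply, Equiv.Perm.coe_pow]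
        rfl
      refine ⟨ge ^ n * fe ^ m * γ, mul_mem (mul_mem
        (pow_mem (Subgroup.subset_closure (by simp)) _)
        (pow_mem (Subgroup.subset_closure (by simp)) _)) hγ, ?_⟩
      rw [heq]
      exact ⟨hg.iterate_mem_pDisk (hf.iterate_mem_pDisk hmem m) n, hmn⟩
  obtain ⟨N, hN⟩ := PadicInt.exists_pow_dvd_imp_norm_lt (p := p) hε
  obtain ⟨γ, hγ, -, h₁, h₂⟩ := happrox N
  refine ⟨γ, hγ, ?_⟩
  rw [dist_comm, Prod.dist_eq, max_lt_iff, dist_eq_norm, dist_eq_norm]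
  exact ⟨hN _ ((pow_dvd_pow _ N.le_succ).trans h₁), hN _ ((pow_dvd_pow _ N.le_succ).trans h₂)⟩
end
end

section
/- Let K be an algebraically closed field, let N > 1 be a natural number, and let x ∈ K. Then T_N(x) = x (evaluation of the monic Chebyshev polynomial T_N) if and only if there exists λ ∈ K with (λ^{N−1} = 1 or λ^{N+1} = 1) and x = λ + λ⁻¹. -/
open Polynomial

noncomputable section

theorem aeval_chebTAux_add_of_mul_eq_one {R : Type*} [CommRing R] (a b : R) (h : a * b = 1)
    (n : ℕ) : aeval (a + b) (chebTAux n) = a ^ n + b ^ n := by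
  induction n using Nat.twoStepInduction with
  | zero => simp [chebTAux, one_add_one_eq_two, map_ofNat (aeval (R := ℤ) (a + b)) 2]
  | one => simp [chebTAux]
  | more n ih₀ ih₁ =>
    rw [chebTAux, map_sub, map_mul, aeval_X, ih₀, ih₁]
    linear_combination (b ^ n + a ^ n) * h

theorem exists_ne_zero_eq_add_inv {K : Type*} [Field K] [IsAlgClosed K] (x : K) :
    ∃ a : K, a ≠ 0 ∧ x = a + a⁻¹ := by
  have hdeg : (X ^ 2 + C (-x) * X + C 1 : K[X]).degree = 2 := by
    simpa using degree_quadratic (a := (1 : K)) (b := -x) (c := 1) one_ne_zero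
  obtain ⟨a, ha⟩ := IsAlgClosed.exists_root (X ^ 2 + C (-x) * X + C 1 : K[X])
    (by rw [hdeg]; exact two_ne_zero)
  have hroot : a ^ 2 + -x * a + 1 = 0 := by simpa [IsRoot] using ha
  have ha0 : a ≠ 0 := by
    rintro rfl
    simp at hroot
  refine ⟨a, ha0, ?_⟩
  field_simp
  linear_combination -hroot

theorem pow_add_inv_pow_eq_add_inv_iff {K : Type*} [Field K] {a : K} (ha : a ≠ 0) {n : ℕ}
    (hn : 1 ≤ n) :
    a ^ n + a⁻¹ ^ n = a + a⁻¹ ↔ a ^ (n - 1) = 1 ∨ a ^ (n + 1) = 1 := by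
  obtain ⟨m, rfl⟩ := Nat.exists_eq_add_of_le' hn
  have key : (a ^ m - 1) * (a ^ (m + 1 + 1) - 1) =
      a ^ (m + 1) * (a ^ (m + 1) + a⁻¹ ^ (m + 1) - (a + a⁻¹)) := by
    rw [inv_pow]
    field_simp
    ring
  rw [Nat.add_sub_cancel, ← sub_eq_zero, ← sub_eq_zero (a := a ^ m),
    ← sub_eq_zero (a := a ^ (m + 1 + 1)), ← mul_eq_zero, key, mul_eq_zero]
  simp [ha]

/-- Over an algebraically closed field, for `N > 1`, `T_N(x) = x`
iff `x = λ + λ⁻¹` for some `λ` with `λ^{N-1} = 1` or `λ^{N+1} = 1`. -/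
theorem stmt4 {K : Type*} [Field K] [IsAlgClosed K] (N : ℕ) (hN : 1 < N) (x : K) :
    aeval x (chebT N) = x ↔
      ∃ lam : K, (lam ^ (N - 1) = 1 ∨ lam ^ (N + 1) = 1) ∧ x = lam + lam⁻¹ := by
  have eval_iff (a : K) (ha : a ≠ 0) : aeval (a + a⁻¹) (chebT N) = a + a⁻¹ ↔
      a ^ (N - 1) = 1 ∨ a ^ (N + 1) = 1 := by
    rw [chebT, Int.natAbs_natCast,
      aeval_chebTAux_add_of_mul_eq_one a a⁻¹ (mul_inv_cancel₀ ha),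
      pow_add_inv_pow_eq_add_inv_iff ha hN.le]
  constructor
  · intro h
    obtain ⟨a, ha, rfl⟩ := exists_ne_zero_eq_add_inv x
    exact ⟨a, (eval_iff a ha).mp h, rfl⟩
  · rintro ⟨a, h, rfl⟩
    have ha : a ≠ 0 := by
      rintro rfl
      simp [Nat.sub_ne_zero_of_lt hN] at h
    exact (eval_iff a ha).mpr h
end
end

section
/- Let p be an odd prime and let y₁, y₂ ∈ ℤ_p satisfy |y₁ − y₂|_p ≤ p⁻¹. Then |T_p(y₁) − T_p(y₂)|_p ≤ p⁻¹ · |y₁ − y₂|_p, where T_p(y) denotes the evaluation at y of the monic Chebyshev polynomial T_p. In other words, evaluation of T_p is a p⁻¹-Lipschitz contraction on each residue disk y + pℤ_p. -/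
open Polynomial

noncomputable section

theorem chebTAux_eq_dickson : ∀ n : ℕ, chebTAux n = dickson 1 (1 : ℤ) n
  | 0 => by simp only [chebTAux, dickson_zero]; norm_num
  | 1 => by simp only [chebTAux, dickson_one]
  | n + 2 => by
    rw [chebTAux, dickson_add_two, chebTAux_eq_dickson (n + 1), chebTAux_eq_dickson n, C_1,
      one_mul]

theorem C_dvd_chebTAux_sub_X_pow (p : ℕ) [Fact p.Prime] :
    C (p : ℤ) ∣ chebTAux p - X ^ p := by
  rw [C_dvd_iff_dvd_coeff]
  intro i
  have h : (chebTAux p - X ^ p).map (Int.castRingHom (ZMod p)) = 0 := by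
    rw [Polynomial.map_sub, chebTAux_eq_dickson, map_dickson, map_one, dickson_one_one_zmod_p,
      Polynomial.map_pow, map_X, sub_self]
  rw [← ZMod.intCast_zmod_eq_zero_iff_dvd]
  simpa only [coeff_map, coeff_zero, eq_intCast] using congrArg (fun q => q.coeff i) h

theorem natCast_mul_sub_dvd_pow_sub_pow {R : Type*} [CommRing R] {n : ℕ} {x y : R}
    (h : (n : R) ∣ x - y) : (n : R) * (x - y) ∣ x ^ n - y ^ n := by
  rw [← (Commute.all x y).geom_sum₂_mul]
  exact mul_dvd_mul_right (dvd_geom_sum₂_self h) _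

theorem natCast_mul_sub_dvd_aeval_chebTAux_sub {R : Type*} [CommRing R] (p : ℕ) [Fact p.Prime]
    {x y : R} (h : (p : R) ∣ x - y) :
    (p : R) * (x - y) ∣ aeval x (chebTAux p) - aeval y (chebTAux p) := by
  obtain ⟨q, hq⟩ := C_dvd_chebTAux_sub_X_pow p
  have key (z : R) : aeval z (chebTAux p) = z ^ p + p * aeval z q := by
    rw [eq_add_of_sub_eq' hq]
    simp
  have hsub : x - y ∣ aeval x q - aeval y q := by
    simpa only [aeval_def, eval₂_eq_eval_map] using sub_dvd_eval_sub x y (q.map (algebraMap ℤ R))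
  rw [key, key, add_sub_add_comm, ← mul_sub]
  exact dvd_add (natCast_mul_sub_dvd_pow_sub_pow h) (mul_dvd_mul_left _ hsub)

/-- For an odd prime `p`, evaluation of `T_p` is a `p⁻¹`-Lipschitz
contraction on each residue disk of `ℤ_p`. -/
theorem stmt7 (p : ℕ) [Fact p.Prime] (hodd : Odd p) (y₁ y₂ : ℤ_[p])
    (h : ‖y₁ - y₂‖ ≤ ((p : ℝ))⁻¹) :
    ‖aeval y₁ (chebT p) - aeval y₂ (chebT p)‖ ≤ ((p : ℝ))⁻¹ * ‖y₁ - y₂‖ := by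
  have hdvd : (p : ℤ_[p]) ∣ y₁ - y₂ := by
    rw [← PadicInt.norm_lt_one_iff_dvd]
    exact h.trans_lt (inv_lt_one_of_one_lt₀ (by exact_mod_cast (Fact.out : p.Prime).one_lt))
  obtain ⟨c, hc⟩ := natCast_mul_sub_dvd_aeval_chebTAux_sub p hdvd
  rw [chebT, Int.natAbs_natCast, hc, norm_mul, norm_mul, PadicInt.norm_p]
  exact mul_le_of_le_one_right (by positivity) (PadicInt.norm_le_one c)
end
end

section
/- Let p be an odd prime and let x₀ ∈ ℤ_p. Then there exists a unique x₁ ∈ ℤ_p with |x₁ − x₀|_p ≤ p⁻¹ such that x₁ is a trace of a rational rotation whose order divides p−1 or p+1; that is, there exists λ in the algebraic closure of ℚ_p with (λ^{p−1} = 1 or λ^{p+1} = 1) and the image of x₁ in the algebraic closure of ℚ_p equals λ + λ⁻¹. (Equivalently, each residue disk x₀ + pℤ_p contains a unique fixed point of the map x ↦ T_p(x).) -/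
open Polynomial

noncomputable section

/-- An element `y + y⁻¹` of a field is fixed by the Dickson (monic Chebyshev) polynomial of
index `n` exactly when `y` has order dividing `n - 1` or `n + 1`. -/
theorem dickson_one_one_eval_add_inv_eq_self_iff {K : Type*} [Field K] {n : ℕ} (hn : 1 ≤ n)
    {y : K} (hy : y ≠ 0) :
    (dickson 1 (1 : K) n).eval (y + y⁻¹) = y + y⁻¹ ↔ y ^ (n - 1) = 1 ∨ y ^ (n + 1) = 1 := by
  rw [dickson_one_one_eval_add_inv y y⁻¹ (mul_inv_cancel₀ hy)]
  obtain ⟨m, rfl⟩ := Nat.exists_eq_add_of_le' hn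
  have hyn : y ^ (m + 1) ≠ 0 := pow_ne_zero _ hy
  have key : (y ^ (m + 1) + y⁻¹ ^ (m + 1) - (y + y⁻¹)) * y ^ (m + 1) * y
      = y * ((y ^ m - 1) * (y ^ (m + 1 + 1) - 1)) := by
    have h1 : y * y⁻¹ = 1 := mul_inv_cancel₀ hy
    have h2 : y ^ (m + 1) * y⁻¹ ^ (m + 1) = 1 := by rw [← mul_pow, h1, one_pow]
    linear_combination y * h2 - y ^ (m + 1) * h1
  rw [Nat.add_sub_cancel, ← sub_eq_zero, ← sub_eq_zero (b := (1 : K)),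
    ← sub_eq_zero (a := y ^ (m + 1 + 1)), ← mul_eq_zero]
  constructor
  · intro h
    rw [h, zero_mul, zero_mul] at key
    exact (mul_eq_zero.mp key.symm).resolve_left hy
  · intro h
    rw [h, mul_zero] at key
    simpa [hy, hyn] using key

/-- In an algebraically closed field every element has the form `y + y⁻¹`. -/
theorem exists_eq_add_inv {K : Type*} [Field K] [IsAlgClosed K] (x : K) :
    ∃ y : K, y ≠ 0 ∧ x = y + y⁻¹ := by
  have hdeg : (X ^ 2 - C x * X + 1 : K[X]).degree = 2 := by
    compute_degree!
  obtain ⟨y, hy⟩ := IsAlgClosed.exists_root (X ^ 2 - C x * X + 1 : K[X]) (by simp [hdeg])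
  have hy' : y ^ 2 - x * y + 1 = 0 := by simpa using hy
  have hy0 : y ≠ 0 := by
    rintro rfl
    simp at hy'
  refine ⟨y, hy0, ?_⟩
  field_simp
  linear_combination -hy'

/-- Fixed points of the Dickson polynomial of index `n` in a subring of an algebraically closed
field are the traces of roots of unity of order dividing `n - 1` or `n + 1`. -/
theorem dickson_one_one_eval_eq_self_iff {R K : Type*} [CommRing R] [Field K] [IsAlgClosed K]
    {f : R →+* K} (hf : Function.Injective f) {n : ℕ} (hn : 1 < n) (x : R) :
    (dickson 1 (1 : R) n).eval x = x ↔
      ∃ y : K, (y ^ (n - 1) = 1 ∨ y ^ (n + 1) = 1) ∧ f x = y + y⁻¹ := by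
  have hmap : f ((dickson 1 (1 : R) n).eval x) = (dickson 1 (1 : K) n).eval (f x) := by
    rw [← map_one f, ← map_dickson, eval_map_apply]
  rw [← hf.eq_iff, hmap]
  obtain ⟨z, hz0, hz⟩ := exists_eq_add_inv (f x)
  constructor
  · intro h
    rw [hz] at h
    exact ⟨z, (dickson_one_one_eval_add_inv_eq_self_iff hn.le hz0).mp h, hz⟩
  · rintro ⟨y, hy, hxy⟩
    have hy0 : y ≠ 0 := by
      rintro rfl
      simp [zero_pow_eq] at hy
      omega
    rw [hxy]
    exact (dickson_one_one_eval_add_inv_eq_self_iff hn.le hy0).mpr hy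

/-- Each residue disk of `ℤ_[p]` contains exactly one fixed point of the Dickson polynomial of
index `p`. -/
theorem PadicInt.existsUnique_dickson_one_one_eval_eq_self (p : ℕ) [Fact p.Prime] (x₀ : ℤ_[p]) :
    ∃! x : ℤ_[p], ‖x - x₀‖ < 1 ∧ (dickson 1 (1 : ℤ_[p]) p).eval x = x := by
  set F : ℤ_[p][X] := dickson 1 1 p - X with hF
  have hmap : F.map PadicInt.toZMod = X ^ p - X := by
    rw [hF, Polynomial.map_sub, map_dickson, map_one, dickson_one_one_zmod_p, map_X]
  have hlt (y : ℤ_[p]) : ‖y‖ < 1 ↔ PadicInt.toZMod y = 0 := by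
    rw [← RingHom.mem_ker, PadicInt.ker_toZMod, IsLocalRing.mem_maximalIdeal,
      PadicInt.mem_nonunits]
  have hval : ‖F.aeval x₀‖ < 1 := by
    rw [coe_aeval_eq_eval, hlt, ← eval_map_apply, hmap]
    simp
  have hder : ‖F.derivative.aeval x₀‖ = 1 := by
    refine le_antisymm (PadicInt.norm_le_one _) (not_lt.mp ?_)
    rw [coe_aeval_eq_eval, hlt, ← eval_map_apply, ← derivative_map, hmap]
    simp [derivative_X_pow]
  obtain ⟨z, hz, hzx, -, huniq⟩ := hensels_lemma (F := F) (a := x₀) (by rwa [hder, one_pow])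
  have hroot (y : ℤ_[p]) : F.aeval y = 0 ↔ (dickson 1 (1 : ℤ_[p]) p).eval y = y := by
    simp [hF, sub_eq_zero]
  rw [hder] at hzx huniq
  exact ⟨z, ⟨hzx, (hroot z).mp hz⟩, fun y hy ↦ huniq y ((hroot y).mpr hy.2) hy.1⟩

/-- For an odd prime `p`, every residue disk `x₀ + pℤ_p` contains a
unique `x₁` which is a trace of a rational rotation of order dividing `p - 1` or `p + 1`:
its image in the algebraic closure of `ℚ_p` is `λ + λ⁻¹` for some `λ` with
`λ^{p-1} = 1` or `λ^{p+1} = 1`. -/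
theorem stmt8 (p : ℕ) [Fact p.Prime] (hodd : Odd p) (x₀ : ℤ_[p]) :
    ∃! x₁ : ℤ_[p], ‖x₁ - x₀‖ ≤ ((p : ℝ))⁻¹ ∧
      ∃ lam : AlgebraicClosure ℚ_[p], (lam ^ (p - 1) = 1 ∨ lam ^ (p + 1) = 1) ∧
        algebraMap ℚ_[p] (AlgebraicClosure ℚ_[p]) (x₁ : ℚ_[p]) = lam + lam⁻¹ := by
  have hinj : Function.Injective
      ((algebraMap ℚ_[p] (AlgebraicClosure ℚ_[p])).comp (PadicInt.Coe.ringHom (p := p))) :=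
    (algebraMap ℚ_[p] (AlgebraicClosure ℚ_[p])).injective.comp Subtype.coe_injective
  refine (existsUnique_congr fun x ↦ and_congr ?_ ?_).mp
    (PadicInt.existsUnique_dickson_one_one_eval_eq_self p x₀)
  · simpa using (PadicInt.norm_le_pow_iff_norm_lt_pow_add_one (x - x₀) (-1)).symm
  · exact dickson_one_one_eval_eq_self_iff hinj (Fact.out : p.Prime).one_lt x
end
end

section
/- Let p be an odd prime, let x₀ ∈ ℤ_p satisfy |x₀ − 2|_p = 1 and |x₀ + 2|_p = 1, and let x₁ ∈ ℤ_p be an element with |x₁ − x₀|_p ≤ p⁻¹ and T_p(x₁) = x₁ (evaluation of the monic Chebyshev polynomial T_p). Set N = (p² − 1)/2, and note that x₀² − 4 is a unit of ℤ_p. Then for every u ∈ ℤ_p, every entry of the matrix C(x₀ + pu)^N − ( I₂ + (N/(x₀² − 4)) · (x₀ − x₁ + pu) · [[x₀, −2], [2, −x₀]] ) has norm at most p⁻², and every entry of the matrix C(x₀ + pu)^{pN} − ( I₂ + (pN/(x₀² − 4)) · (x₀ − x₁ + pu) · [[x₀, −2], [2, −x₀]] ) has norm at most p⁻³. -/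
open Polynomial

noncomputable section

theorem chebTAux_eq_chebyshev_C : ∀ n : ℕ, chebTAux n = Chebyshev.C ℤ n
  | 0 => by simp [chebTAux]
  | 1 => by simp [chebTAux]
  | n + 2 => by
    rw [chebTAux, chebTAux_eq_chebyshev_C n, chebTAux_eq_chebyshev_C (n + 1)]
    push_cast
    rw [Chebyshev.C_add_two]

theorem sq_sub_four_mul_derivative_S {R : Type*} [CommRing R] (n : ℤ) :
    (X ^ 2 - 4) * derivative (Chebyshev.S R n) =
      (n : R[X]) * X * Chebyshev.S R n - 2 * ((n : R[X]) + 1) * Chebyshev.S R (n - 1) := by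
  induction n using Chebyshev.induct with
  | zero => simp
  | one =>
    simp
    ring
  | add_two n ih1 ih2 =>
    have h1 := Chebyshev.S_add_two R n
    have h2 := Chebyshev.S_add_one R n
    rw [show (n : ℤ) + 2 - 1 = n + 1 by ring, h1]
    rw [add_sub_cancel_right] at ih1
    simp only [derivative_sub, derivative_mul, derivative_X]
    push_cast at ih1 ih2 ⊢
    linear_combination X * ih1 - ih2 + 2 * ((n : R[X]) + 1) * h2
  | neg_add_one n ih1 ih2 =>
    have h1 := Chebyshev.S_sub_one R (-n)
    have h2 := Chebyshev.S_sub_two R (-n)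
    rw [show (-n : ℤ) - 1 - 1 = -n - 2 by ring, h2, h1]
    rw [add_sub_cancel_right] at ih2
    simp only [derivative_sub, derivative_mul, derivative_X]
    rw [h1] at ih1
    push_cast at ih1 ih2 ⊢
    linear_combination X * ih1 - ih2

theorem cmat_pow {R : Type*} [CommRing R] (x : R) (n : ℕ) :
    cmat x ^ n = !![(Chebyshev.S R n).eval x, -(Chebyshev.S R (n - 1)).eval x;
      (Chebyshev.S R (n - 1)).eval x,
      (Chebyshev.S R n).eval x - x * (Chebyshev.S R (n - 1)).eval x] := by
  induction n with
  | zero => simp [Matrix.one_fin_two]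
  | succ n ih =>
    have h := congrArg (eval x) (Chebyshev.S_add_one R n)
    simp only [eval_sub, eval_mul, eval_X] at h
    rw [pow_succ, ih, cmat]
    push_cast
    rw [add_sub_cancel_right, h]
    ext i j
    fin_cases i <;> fin_cases j <;> simp [Matrix.mul_apply] <;> ring

theorem cmat_pow_eq_one_of_chebyshev_C_fixed {R : Type*} [CommRing R] [IsDomain R] [CharZero R]
    {x : R} (hx : x ^ 2 - 4 ≠ 0) {n : ℕ} (hn : Odd n)
    (hfix : (Chebyshev.C R n).eval x = x) : cmat x ^ ((n ^ 2 - 1) / 2) = 1 := by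
  obtain ⟨m, rfl⟩ := hn
  have hN : ((2 * m + 1) ^ 2 - 1) / 2 = 2 * m * (m + 1) := by
    rw [show (2 * m + 1) ^ 2 - 1 = 2 * (2 * m * (m + 1)) by
      rw [Nat.sub_eq_iff_eq_add (Nat.one_le_pow _ _ (by lia))]; ring]
    exact Nat.mul_div_cancel_left _ two_pos
  rw [hN]
  have hpow := cmat_pow x (2 * m + 1)
  have htr := congrArg (eval x) (Chebyshev.C_eq_S_sub_X_mul_S R ((2 * m + 1 : ℕ) : ℤ))
  have hdet := congrArg (eval x) (Chebyshev.S_sq_add_S_sq R (((2 * m + 1 : ℕ) : ℤ) - 1))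
  rw [hfix] at htr
  simp only [sub_add_cancel, eval_sub, eval_add, eval_mul, eval_pow, eval_X, eval_one,
    eval_ofNat] at htr hdet
  generalize (Chebyshev.S R ((2 * m + 1 : ℕ) : ℤ)).eval x = s at *
  generalize (Chebyshev.S R (((2 * m + 1 : ℕ) : ℤ) - 1)).eval x = a at *
  have hprod : (a - 1) * (a + 1) = 0 := by
    refine (mul_eq_zero.mp ?_).resolve_right hx
    linear_combination (-4) * hdet - (2 * s + x * (1 + a) - 2 * x * a) * htr
  have hunit : IsUnit (cmat x) := by
    rw [Matrix.isUnit_iff_isUnit_det]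
    simp [cmat, Matrix.det_fin_two]
  rcases mul_eq_zero.mp hprod with ha | ha
  · obtain rfl : a = 1 := by linear_combination ha
    obtain rfl : s = x := mul_left_cancel₀ (two_ne_zero (α := R)) (by linear_combination -htr)
    have h1 : cmat s ^ (2 * m) = 1 := by
      refine hunit.mul_right_cancel ?_
      rw [← pow_succ, hpow, cmat]
      simp
    rw [pow_mul, h1, one_pow]
  · obtain rfl : a = -1 := by linear_combination ha
    obtain rfl : s = 0 := mul_left_cancel₀ (two_ne_zero (α := R)) (by linear_combination -htr)
    have h1 : cmat x ^ (2 * (m + 1)) = 1 := by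
      rw [show 2 * (m + 1) = 2 * m + 1 + 1 by ring, pow_succ, hpow, cmat]
      ext i j
      fin_cases i <;> fin_cases j <;> simp [Matrix.mul_apply]
    rw [show 2 * m * (m + 1) = 2 * (m + 1) * m by ring, pow_mul, h1, one_pow]

theorem exists_one_add_pow_eq {R : Type*} [Ring R] (a : R) (n : ℕ) :
    ∃ q, (1 + a) ^ n = 1 + n * a + n.choose 2 * a ^ 2 + q * a ^ 3 := by
  induction n with
  | zero => exact ⟨0, by simp⟩
  | succ n ih =>
    obtain ⟨q, hq⟩ := ih
    refine ⟨q + n.choose 2 + q * a, ?_⟩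
    rw [pow_succ, hq, Nat.choose_succ_succ, Nat.choose_one_right]
    push_cast
    noncomm_ring

theorem exists_one_add_prime_mul_pow_prime_eq {R : Type*} [Ring R] {p : ℕ} (hp : p.Prime)
    (hodd : Odd p) (a : R) :
    ∃ q, (1 + p * a) ^ p = 1 + (p : R) ^ 2 * a + (p : R) ^ 3 * q := by
  obtain ⟨q, hq⟩ := exists_one_add_pow_eq (p * a) p
  obtain ⟨c, hc⟩ := hp.dvd_choose_self two_ne_zero
    (hp.two_le.lt_of_ne fun h ↦ by simp [← h, Nat.odd_iff] at hodd)
  have hcomm : ∀ b : R, Commute (p : R) b := Nat.cast_commute p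
  refine ⟨c * a ^ 2 + q * a ^ 3, ?_⟩
  rw [hq, hc, (hcomm a).mul_pow, (hcomm a).mul_pow, ← mul_assoc q, ← ((hcomm q).pow_left 3).eq]
  push_cast
  rw [mul_assoc (p : R) (c : R), ← mul_assoc (c : R), ← ((hcomm (c : R)).pow_left 2).eq]
  noncomm_ring

/-- First-order expansion of `C(y)^N` around a point `x` with `C(x)^N = 1`. -/
theorem exists_cmat_add_pow_eq {R : Type*} [CommRing R] {x e : R} (he : e * (x ^ 2 - 4) = 1)
    {N : ℕ} (hN : cmat x ^ N = 1) (h : R) :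
    ∃ Z : Matrix (Fin 2) (Fin 2) R,
      cmat (x + h) ^ N = 1 + (N * e * h) • !![x, -2; 2, -x] + h ^ 2 • Z := by
  rw [cmat_pow] at hN
  have hS : (Chebyshev.S R N).eval x = 1 := by simpa using congrFun (congrFun hN 0) 0
  have hS1 : (Chebyshev.S R (N - 1)).eval x = 0 := by simpa using congrFun (congrFun hN 1) 0
  have hS2 : (Chebyshev.S R (N - 1 - 1)).eval x = -1 := by
    have := congrArg (eval x) (Chebyshev.S_sub_two R N)
    rw [show (N : ℤ) - 1 - 1 = N - 2 by ring, this]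
    simp [hS, hS1]
  have hd := congrArg (eval x) (sq_sub_four_mul_derivative_S (R := R) N)
  have hd1 := congrArg (eval x) (sq_sub_four_mul_derivative_S (R := R) (N - 1))
  simp only [eval_sub, eval_add, eval_mul, eval_pow, eval_X, eval_ofNat, eval_one,
    eval_intCast, hS, hS1, hS2] at hd hd1
  push_cast at hd hd1
  obtain ⟨k, hk⟩ := binomExpansion (Chebyshev.S R N) x h
  obtain ⟨k1, hk1⟩ := binomExpansion (Chebyshev.S R (N - 1)) x h
  rw [hS] at hk
  rw [hS1] at hk1
  generalize (derivative (Chebyshev.S R N)).eval x = d at *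
  generalize (derivative (Chebyshev.S R (N - 1))).eval x = d1 at *
  have hd' : d = N * e * x := by linear_combination e * hd - d * he
  have hd1' : d1 = 2 * N * e := by linear_combination e * hd1 - d1 * he
  refine ⟨!![k, -k1; k1, k - x * k1 - d1 - k1 * h], ?_⟩
  rw [cmat_pow, hk, hk1, hd', hd1']
  ext i j
  fin_cases i <;> fin_cases j <;> simp <;> ring

theorem PadicInt.norm_le_inv_pow_of_dvd {p : ℕ} [Fact p.Prime] {z : ℤ_[p]} {n : ℕ}
    (h : (p : ℤ_[p]) ^ n ∣ z) : ‖z‖ ≤ ((p : ℝ))⁻¹ ^ n := by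
  have := (PadicInt.norm_le_pow_iff_mem_span_pow z n).mpr (Ideal.mem_span_singleton.mpr h)
  rwa [zpow_neg, zpow_natCast, ← inv_pow] at this

/-- Estimates on `C(x₀ + pu)^N` and `C(x₀ + pu)^{pN}` for
`N = (p² - 1)/2`, when `x₀ ≢ ±2 (mod p)` and `x₁` is the fixed point of `T_p`
in the disk `x₀ + pℤ_p`. -/
theorem stmt10 (p : ℕ) [Fact p.Prime] (hodd : Odd p) (x₀ : ℤ_[p])
    (h2 : ‖x₀ - 2‖ = 1) (h2' : ‖x₀ + 2‖ = 1)
    (x₁ : ℤ_[p]) (hx₁ : ‖x₁ - x₀‖ ≤ ((p : ℝ))⁻¹) (hfix : aeval x₁ (chebT p) = x₁) :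
    IsUnit (x₀ ^ 2 - 4) ∧
    ∀ u : ℤ_[p], ∀ i j : Fin 2,
      ‖(cmat (x₀ + p * u) ^ ((p ^ 2 - 1) / 2) -
          (1 + ((((p ^ 2 - 1) / 2 : ℕ) : ℤ_[p]) * Ring.inverse (x₀ ^ 2 - 4) *
            (x₀ - x₁ + p * u)) • !![x₀, -2; 2, -x₀]) :
          Matrix (Fin 2) (Fin 2) ℤ_[p]) i j‖ ≤ ((p : ℝ))⁻¹ ^ 2 ∧
      ‖(cmat (x₀ + p * u) ^ (p * ((p ^ 2 - 1) / 2)) -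
          (1 + (((p * ((p ^ 2 - 1) / 2) : ℕ) : ℤ_[p]) * Ring.inverse (x₀ ^ 2 - 4) *
            (x₀ - x₁ + p * u)) • !![x₀, -2; 2, -x₀]) :
          Matrix (Fin 2) (Fin 2) ℤ_[p]) i j‖ ≤ ((p : ℝ))⁻¹ ^ 3 := by
  have hu0 : IsUnit (x₀ ^ 2 - 4) := by
    rw [PadicInt.isUnit_iff, show x₀ ^ 2 - 4 = (x₀ - 2) * (x₀ + 2) by ring, norm_mul, h2, h2',
      one_mul]
  refine ⟨hu0, fun u ↦ ?_⟩
  obtain ⟨m, hm⟩ : (p : ℤ_[p]) ∣ x₁ - x₀ := by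
    have := (PadicInt.norm_le_pow_iff_mem_span_pow (x₁ - x₀) 1).mp (by simpa using hx₁)
    simpa [Ideal.mem_span_singleton] using this
  obtain rfl : x₁ = x₀ + p * m := by linear_combination hm
  have hu1 : IsUnit ((x₀ + p * m) ^ 2 - 4) := by
    have hmem : (p : ℤ_[p]) * (m * (2 * x₀ + p * m)) ∈ IsLocalRing.maximalIdeal ℤ_[p] :=
      Ideal.mul_mem_right _ _ PadicInt.p_nonunit
    by_contra hcon
    refine (IsLocalRing.mem_maximalIdeal _).mp ?_ hu0
    convert sub_mem ((IsLocalRing.mem_maximalIdeal _).mpr hcon) hmem using 1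
    ring
  have hfix' : (Chebyshev.C ℤ_[p] p).eval (x₀ + p * m) = x₀ + p * m := by
    rwa [chebT, Int.natAbs_natCast, chebTAux_eq_chebyshev_C, Chebyshev.aeval_C] at hfix
  have hA := cmat_pow_eq_one_of_chebyshev_C_fixed hu1.ne_zero hodd hfix'
  obtain ⟨e, he⟩ := hu1.exists_left_inv
  have hc := Ring.inverse_mul_cancel _ hu0
  generalize Ring.inverse (x₀ ^ 2 - 4) = c at *
  generalize (p ^ 2 - 1) / 2 = N at *
  have hfirst : ∃ Z : Matrix (Fin 2) (Fin 2) ℤ_[p], cmat (x₀ + p * u) ^ N =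
      1 + (N * c * (x₀ - (x₀ + p * m) + p * u)) • !![x₀, -2; 2, -x₀] + (p : ℤ_[p]) ^ 2 • Z := by
    obtain ⟨Z, hZ⟩ := exists_cmat_add_pow_eq he hA (p * (u - m))
    have hec : e - c = -(p * (e * c * (m * (2 * x₀ + p * m)))) := by
      linear_combination c * he - e * hc
    refine ⟨(u - m) ^ 2 • Z + (N * (u - m)) • (-(e * c * (m * (2 * x₀ + p * m))) •
      !![x₀, -2; 2, -x₀] + e • !![m, 0; 0, -m]), ?_⟩
    rw [show x₀ + p * u = x₀ + p * m + p * (u - m) by ring, hZ]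
    ext i j
    fin_cases i <;> fin_cases j <;> simp
    · linear_combination (N * (p * (u - m)) * x₀) * hec
    · linear_combination (N * (p * (u - m)) * (-2)) * hec
    · linear_combination (N * (p * (u - m)) * 2) * hec
    · linear_combination (N * (p * (u - m)) * (-x₀)) * hec
  obtain ⟨Z, hZ⟩ := hfirst
  intro i j
  constructor
  · refine PadicInt.norm_le_inv_pow_of_dvd ⟨Z i j, ?_⟩
    rw [hZ, add_sub_cancel_left, Matrix.smul_apply, smul_eq_mul]
  · obtain ⟨Q, hQ⟩ := exists_one_add_prime_mul_pow_prime_eq (Fact.out : p.Prime) hodd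
      ((N * c * (u - m)) • !![x₀, -2; 2, -x₀] + (p : ℤ_[p]) • Z)
    refine PadicInt.norm_le_inv_pow_of_dvd ⟨Z i j + Q i j, ?_⟩
    have hcast (n : ℕ) (M : Matrix (Fin 2) (Fin 2) ℤ_[p]) : n * M = (n : ℤ_[p]) • M := by
      rw [← nsmul_eq_mul, Nat.cast_smul_eq_nsmul]
    rw [← Nat.cast_pow, ← Nat.cast_pow, hcast, hcast, hcast] at hQ
    have hbase : cmat (x₀ + p * u) ^ N =
        1 + (p : ℤ_[p]) • ((N * c * (u - m)) • !![x₀, -2; 2, -x₀] + (p : ℤ_[p]) • Z) := by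
      rw [hZ, smul_add, smul_smul, smul_smul, ← pow_two, ← add_assoc]
      congr 3
      ring
    rw [mul_comm p N, pow_mul, hbase, hQ]
    simp only [Matrix.sub_apply, Matrix.add_apply, Matrix.smul_apply, smul_eq_mul]
    push_cast
    ring
end
end

section
/- Let p > 3 be a prime and let x₀ ∈ ℤ_p satisfy |x₀ − 2|_p ≤ p⁻¹ or |x₀ + 2|_p ≤ p⁻¹. Then for every u ∈ ℤ_p, every entry of the matrix C(x₀ + pu)^{2p} − ( I₂ + p · [[2, −x₀], [x₀, −2]] ) has norm at most p⁻², and every entry of the matrix C(x₀ + pu)^{2p²} − ( I₂ + p² · [[2, −x₀], [x₀, −2]] ) has norm at most p⁻³. -/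
open Polynomial

noncomputable section

theorem natCast_pow_dvd_one_add_pow_prime_sub {R : Type*} [Ring R] {p e : ℕ} (hp : p.Prime)
    {b : R} (hsq : (p : R) ^ e ∣ b ^ 2) (hpow : (p : R) ^ (e + 1) ∣ b ^ p) :
    (p : R) ^ (e + 1) ∣ (1 + b) ^ p - (1 + p * b) := by
  obtain ⟨q, rfl⟩ := Nat.exists_eq_add_of_le' hp.two_le
  have hsum : (1 + b) ^ (q + 2) - (1 + ((q + 2 : ℕ) : R) * b) =
      ∑ i ∈ Finset.range (q + 1), b ^ (i + 2) * ((q + 2).choose (i + 2) : R) := by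
    rw [add_comm 1 b, (Commute.one_right b).add_pow, Finset.sum_range_succ',
      Finset.sum_range_succ']
    simp only [one_pow, mul_one, zero_add, pow_zero, pow_one, Nat.choose_zero_right,
      Nat.choose_one_right, Nat.cast_one, add_assoc, Nat.reduceAdd]
    rw [(Nat.cast_commute (q + 2) b).eq]
    abel
  rw [hsum]
  refine Finset.dvd_sum fun i hi => ?_
  rcases Nat.lt_or_ge i q with hiq | hiq
  · obtain ⟨c, hc⟩ := hp.dvd_choose_self (k := i + 2) (by omega) (by omega)
    obtain ⟨d, hd⟩ := hsq
    rw [hc, add_comm i 2, pow_add b, hd, Nat.cast_mul, pow_succ]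
    refine ⟨d * b ^ i * c, ?_⟩
    calc _ = ((q + 2 : ℕ) : R) ^ e * (d * b ^ i * ((q + 2 : ℕ) : R)) * c := by
          simp only [mul_assoc]
      _ = _ := by
          rw [← (Nat.cast_commute (q + 2) (d * b ^ i)).eq]
          simp only [mul_assoc]
  · obtain rfl : i = q := by have := Finset.mem_range.mp hi; omega
    exact hpow.mul_right _

theorem exists_one_add_pow_prime_eq_of_sq {R : Type*} [Ring R] {p : ℕ} (hp : p.Prime)
    (h3 : 3 < p) {b : R} (hsq : (p : R) ∣ b ^ 2) :
    ∃ d, (1 + b) ^ p = 1 + p * (b + p * d) := by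
  have hpow : (p : R) ^ (1 + 1) ∣ b ^ p := by
    obtain ⟨c, hc⟩ := hsq
    have h4 : (p : R) ^ (1 + 1) ∣ b ^ 4 := by
      refine ⟨c * c, ?_⟩
      rw [show 4 = 2 + 2 from rfl, pow_add, hc, pow_succ, pow_one, mul_assoc, ← mul_assoc c,
        ← (Nat.cast_commute p c).eq]
      simp only [mul_assoc]
    exact h4.trans (pow_dvd_pow b h3)
  obtain ⟨d, hd⟩ := natCast_pow_dvd_one_add_pow_prime_sub hp (e := 1) (by simpa using hsq) hpow
  refine ⟨d, ?_⟩
  rw [sub_eq_iff_eq_add.mp hd, pow_succ, pow_one]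
  noncomm_ring

theorem exists_one_add_mul_pow_prime_eq {R : Type*} [Ring R] {p : ℕ} (hp : p.Prime)
    (h3 : 3 ≤ p) (a : R) :
    ∃ d, (1 + p * a) ^ p = 1 + (p : R) ^ 2 * (a + p * d) := by
  have hmul (n : ℕ) : ((p : R) * a) ^ n = (p : R) ^ n * a ^ n := (Nat.cast_commute p a).mul_pow n
  obtain ⟨d, hd⟩ := natCast_pow_dvd_one_add_pow_prime_sub hp (e := 2) (b := (p : R) * a)
    (hmul 2 ▸ dvd_mul_right _ _) (hmul p ▸ (pow_dvd_pow _ h3).mul_right _)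
  refine ⟨d, ?_⟩
  rw [sub_eq_iff_eq_add.mp hd]
  noncomm_ring

theorem cmat_sq_sub_one_sq {R : Type*} [CommRing R] (x : R) :
    (cmat x ^ 2 - 1) ^ 2 = (x ^ 2 - 4) • cmat x ^ 2 := by
  ext i j
  fin_cases i <;> fin_cases j <;>
    simp [cmat, pow_two, Matrix.mul_apply, Fin.sum_univ_two, Matrix.one_fin_two] <;> ring

theorem cmat_add_mul_sq {R : Type*} [CommRing R] {x₀ u t s : R}
    (hs : (x₀ + t * u) ^ 2 - 4 = t * s) :
    cmat (x₀ + t * u) ^ 2 = 1 + (!![2, -x₀; x₀, -2] + t • !![s, -u; u, 0]) := by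
  ext i j
  fin_cases i <;> fin_cases j <;>
    simp [cmat, pow_two, Matrix.one_fin_two]
  · linear_combination hs
  · ring
  · norm_num

theorem natCast_matrix_mul {n R : Type*} [Fintype n] [DecidableEq n] [CommRing R] (k : ℕ)
    (A : Matrix n n R) : (k : Matrix n n R) * A = (k : R) • A := by
  rw [← nsmul_eq_mul, Nat.cast_smul_eq_nsmul]

theorem PadicInt.norm_le_inv_pow_iff_dvd {p : ℕ} [Fact p.Prime] (x : ℤ_[p]) (n : ℕ) :
    ‖x‖ ≤ ((p : ℝ))⁻¹ ^ n ↔ (p : ℤ_[p]) ^ n ∣ x := by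
  rw [← Ideal.mem_span_singleton, ← PadicInt.norm_le_pow_iff_mem_span_pow, zpow_neg,
    zpow_natCast, inv_pow]

/-- Estimates on `C(x₀ + pu)^{2p}` and `C(x₀ + pu)^{2p²}` for a
prime `p > 3` when `x₀ ≡ ±2 (mod p)`. -/
theorem stmt11 (p : ℕ) [Fact p.Prime] (hp : 3 < p) (x₀ : ℤ_[p])
    (h : ‖x₀ - 2‖ ≤ ((p : ℝ))⁻¹ ∨ ‖x₀ + 2‖ ≤ ((p : ℝ))⁻¹) :
    ∀ u : ℤ_[p], ∀ i j : Fin 2,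
      ‖((cmat (x₀ + p * u) ^ (2 * p) -
        (1 + (p : ℤ_[p]) • !![2, -x₀; x₀, -2]) : Matrix (Fin 2) (Fin 2) ℤ_[p])) i j‖
          ≤ ((p : ℝ))⁻¹ ^ 2 ∧
      ‖((cmat (x₀ + p * u) ^ (2 * p ^ 2) -
        (1 + ((p : ℤ_[p]) ^ 2) • !![2, -x₀; x₀, -2]) : Matrix (Fin 2) (Fin 2) ℤ_[p])) i j‖
          ≤ ((p : ℝ))⁻¹ ^ 3 := by
  intro u i j
  have hprime : p.Prime := Fact.out
  obtain ⟨s, hs⟩ : (p : ℤ_[p]) ∣ (x₀ + p * u) ^ 2 - 4 := by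
    have hdvd : (p : ℤ_[p]) ∣ (x₀ - 2) * (x₀ + 2) := by
      rcases h with h | h
      · exact Dvd.dvd.mul_right (by
          simpa using (PadicInt.norm_le_inv_pow_iff_dvd (x₀ - 2) 1).mp (by simpa using h)) _
      · exact Dvd.dvd.mul_left (by
          simpa using (PadicInt.norm_le_inv_pow_iff_dvd (x₀ + 2) 1).mp (by simpa using h)) _
    obtain ⟨c, hc⟩ := hdvd
    exact ⟨c + 2 * x₀ * u + p * u ^ 2, by linear_combination hc⟩
  have hsq : (p : Matrix (Fin 2) (Fin 2) ℤ_[p]) ∣ (cmat (x₀ + p * u) ^ 2 - 1) ^ 2 :=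
    ⟨s • cmat (x₀ + p * u) ^ 2, by
      rw [cmat_sq_sub_one_sq, hs, natCast_matrix_mul, mul_smul]⟩
  obtain ⟨d, hd⟩ := exists_one_add_pow_prime_eq_of_sq hprime hp hsq
  rw [add_sub_cancel, ← pow_mul, cmat_add_mul_sq hs |> sub_eq_of_eq_add'] at hd
  obtain ⟨d', hd'⟩ := exists_one_add_mul_pow_prime_eq hprime hp.le
    (!![2, -x₀; x₀, -2] + (p : ℤ_[p]) • !![s, -u; u, 0] +
      (p : Matrix (Fin 2) (Fin 2) ℤ_[p]) * d)
  rw [← hd, ← pow_mul, mul_assoc, ← pow_two] at hd'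
  simp only [PadicInt.norm_le_inv_pow_iff_dvd]
  constructor
  · refine ⟨(!![s, -u; u, 0] + d) i j,
      congrFun₂ (?_ : _ = (p : ℤ_[p]) ^ 2 • (!![s, -u; u, 0] + d)) i j⟩
    rw [hd]
    simp only [natCast_matrix_mul]
    module
  · refine ⟨(!![s, -u; u, 0] + d + d') i j,
      congrFun₂ (?_ : _ = (p : ℤ_[p]) ^ 3 • (!![s, -u; u, 0] + d + d')) i j⟩
    rw [hd', pow_two (p : Matrix (Fin 2) (Fin 2) ℤ_[p]), mul_assoc]
    simp only [natCast_matrix_mul]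
    module
end
end

section
/- Let p be a prime. Each of the Vieta involutions s_x, s_y, s_z is an isometry of ℤ_p³ for the sup distance: for all a, b ∈ ℤ_p³ one has dist(s_x(a), s_x(b)) = dist(a, b), dist(s_y(a), s_y(b)) = dist(a, b), and dist(s_z(a), s_z(b)) = dist(a, b). -/
open Polynomial

noncomputable section

theorem Function.Involutive.dist_toPerm_eq {α : Type*} [PseudoMetricSpace α] {f : α → α}
    (hf : f.Involutive) (h : ∀ a b, dist (f a) (f b) ≤ dist a b) (a b : α) :
    dist (hf.toPerm f a) (hf.toPerm f b) = dist a b := by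
  refine le_antisymm (h a b) ?_
  simpa only [hf a, hf b, Function.Involutive.coe_toPerm] using h (f a) (f b)

theorem PadicInt.dist_mul_sub_le {p : ℕ} [Fact p.Prime] {x y z x' y' z' : ℤ_[p]} {r : ℝ}
    (hx : dist x x' ≤ r) (hy : dist y y' ≤ r) (hz : dist z z' ≤ r) :
    dist (y * z - x) (y' * z' - x') ≤ r := by
  rw [dist_eq_norm] at *
  have hyz : ‖y * (z - z') + (y - y') * z'‖ ≤ r := by
    refine (PadicInt.nonarchimedean _ _).trans (max_le ?_ ?_)
    · rw [norm_mul]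
      exact (mul_le_of_le_one_left (norm_nonneg _) (PadicInt.norm_le_one y)).trans hz
    · rw [norm_mul]
      exact (mul_le_of_le_one_right (norm_nonneg _) (PadicInt.norm_le_one z')).trans hy
  have hsplit : y * z - x - (y' * z' - x') =
      (y * (z - z') + (y - y') * z') + -(x - x') := by ring
  rw [hsplit]
  exact (PadicInt.nonarchimedean _ _).trans (max_le hyz (by rwa [norm_neg]))

/-- Each Vieta involution is an isometry of `ℤ_p³` for the sup
distance. -/
theorem stmt12 (p : ℕ) [Fact p.Prime] (a b : ℤ_[p] × ℤ_[p] × ℤ_[p]) :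
    dist (vietaSx ℤ_[p] a) (vietaSx ℤ_[p] b) = dist a b ∧
    dist (vietaSy ℤ_[p] a) (vietaSy ℤ_[p] b) = dist a b ∧
    dist (vietaSz ℤ_[p] a) (vietaSz ℤ_[p] b) = dist a b := by
  have hcoord (a b : ℤ_[p] × ℤ_[p] × ℤ_[p]) : dist a.1 b.1 ≤ dist a b ∧
      dist a.2.1 b.2.1 ≤ dist a b ∧ dist a.2.2 b.2.2 ≤ dist a b := by
    simp [Prod.dist_eq]
  refine ⟨Function.Involutive.dist_toPerm_eq _ (fun a b => ?_) a b,
    Function.Involutive.dist_toPerm_eq _ (fun a b => ?_) a b,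
    Function.Involutive.dist_toPerm_eq _ (fun a b => ?_) a b⟩ <;>
  obtain ⟨hx, hy, hz⟩ := hcoord a b
  · exact max_le (PadicInt.dist_mul_sub_le hx hy hz) (max_le hy hz)
  · exact max_le hx (max_le (PadicInt.dist_mul_sub_le hy hx hz) hz)
  · exact max_le hx (max_le hy (PadicInt.dist_mul_sub_le hz hx hy))
end
end

section
/- Let (x₀, y₀, z₀) ∈ ℤ_p³. (a) If p is an odd prime and |x₀ − 2|_p = 1 and |x₀ + 2|_p = 1, then the point obtained by applying the map s_y ∘ s_z to (x₀, y₀, z₀) exactly (p² − 1)/4 times is congruent to (x₀, y₀, z₀) modulo p, i.e., its sup distance to (x₀, y₀, z₀) is at most p⁻¹. (b) If p > 3 is a prime and |x₀ − 2|_p ≤ p⁻¹ or |x₀ + 2|_p ≤ p⁻¹, then the point obtained by applying s_y ∘ s_z to (x₀, y₀, z₀) exactly p times is congruent to (x₀, y₀, z₀) modulo p. -/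
open Polynomial

noncomputable section

/-- The powers of `s_y ∘ s_z` act on `(y, z)` by the even powers of the companion matrix,
after reduction along any ring homomorphism. -/
theorem vietaSy_comp_vietaSz_iterate {R S : Type*} [CommRing R] [CommRing S] (f : R →+* S)
    (n : ℕ) (x y z : R) :
    ∃ y' z' : R, (⇑(vietaSy R) ∘ ⇑(vietaSz R))^[n] (x, y, z) = (x, y', z') ∧
      ![f y', f z'] = (cmat (f x) ^ (2 * n)).mulVec ![f y, f z] := by
  induction n with
  | zero => exact ⟨y, z, by simp⟩
  | succ n ih =>
    obtain ⟨y', z', h, h'⟩ := ih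
    refine ⟨x * (x * y' - z') - y', x * y' - z', ?_, ?_⟩
    · rw [Function.iterate_succ_apply', h]
      rfl
    · rw [mul_add, mul_one, add_comm, pow_add, ← Matrix.mulVec_mulVec, ← h']
      ext i
      fin_cases i <;> simp [cmat, pow_two, Matrix.mulVec, dotProduct] <;> ring

theorem cmat_mul_sub {R : Type*} [CommRing R] (x : R) :
    cmat x * (x • (1 : Matrix (Fin 2) (Fin 2) R) - cmat x) = 1 := by
  ext i j
  fin_cases i <;> fin_cases j <;> simp [cmat, Matrix.mul_apply]

/-- The discriminant matrix `2 C(x) - x` squares to the scalar `x² - 4`. -/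
theorem two_smul_cmat_sub_sq {R : Type*} [CommRing R] (x : R) :
    ((2 : R) • cmat x - x • (1 : Matrix (Fin 2) (Fin 2) R)) ^ 2 =
      (x ^ 2 - 4) • (1 : Matrix (Fin 2) (Fin 2) R) := by
  ext i j
  fin_cases i <;> fin_cases j <;> simp [cmat, pow_two, Matrix.mul_apply] <;> ring

/-- Frobenius on `C(x)`: `2 C(x)^p = x + (x² - 4)^((p - 1) / 2) (2 C(x) - x)`. -/
theorem two_smul_cmat_pow_prime {p : ℕ} [Fact p.Prime] (hp : Odd p) (x : ZMod p) :
    (2 : ZMod p) • cmat x ^ p = x • (1 : Matrix (Fin 2) (Fin 2) (ZMod p)) +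
      (x ^ 2 - 4) ^ (p / 2) • ((2 : ZMod p) • cmat x - x • 1) := by
  set D := (2 : ZMod p) • cmat x - x • (1 : Matrix (Fin 2) (Fin 2) (ZMod p)) with hD
  have hDp : D ^ p = (x ^ 2 - 4) ^ (p / 2) • D := by
    calc D ^ p = (D ^ 2) ^ (p / 2) * D := by
          rw [← pow_mul, ← pow_succ, Nat.two_mul_div_two_add_one_of_odd hp]
      _ = _ := by
          rw [hD, two_smul_cmat_sub_sq, ← hD, _root_.smul_pow, one_pow, smul_mul_assoc, one_mul]
  have hsum : (2 : ZMod p) • cmat x = x • 1 + D := by rw [hD]; abel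
  have hcomm : Commute (x • (1 : Matrix (Fin 2) (Fin 2) (ZMod p))) D :=
    (Commute.one_left D).smul_left x
  have := congrArg (· ^ p) hsum
  simpa [add_pow_char_of_commute p hcomm, _root_.smul_pow, ZMod.pow_card, hDp] using this

theorem ZMod.two_ne_zero_of_odd {p : ℕ} [Fact p.Prime] (hp : Odd p) : (2 : ZMod p) ≠ 0 :=
  Ring.two_ne_zero (by rw [ZMod.ringChar_zmod_n]; rintro rfl; exact absurd hp (by decide))

theorem cmat_pow_eq_one {p : ℕ} [Fact p.Prime] (hp : Odd p) {x : ZMod p}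
    (hx : x ^ 2 - 4 ≠ 0) : cmat x ^ (2 * ((p ^ 2 - 1) / 4)) = 1 := by
  have h2 : (2 : ZMod p) ≠ 0 := ZMod.two_ne_zero_of_odd hp
  have hF := two_smul_cmat_pow_prime hp x
  have hinv := cmat_mul_sub x
  obtain ⟨k, hk⟩ := hp
  have hexp : 2 * ((p ^ 2 - 1) / 4) = 2 * k * (k + 1) := by
    have : p ^ 2 - 1 = 4 * (k * (k + 1)) := by
      rw [hk]; apply Nat.sub_eq_of_eq_add; ring
    rw [this, Nat.mul_div_cancel_left _ (by norm_num)]; ring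
  rw [hexp]
  rcases ZMod.pow_div_two_eq_neg_one_or_one p hx with h | h
  · rw [h, one_smul, add_sub_cancel] at hF
    have hC : cmat x ^ p = cmat x := smul_right_injective _ h2 hF
    have : cmat x ^ (2 * k) = 1 := by
      have := congrArg (· * (x • 1 - cmat x)) hC
      simpa only [hk, pow_succ, mul_assoc, hinv, mul_one] using this
    rw [pow_mul, this, one_pow]
  · have hC : cmat x ^ p = x • 1 - cmat x := by
      refine smul_right_injective _ h2 ?_
      simp only [hF, h]
      module
    have : cmat x ^ (2 * (k + 1)) = 1 := by
      rw [show 2 * (k + 1) = p + 1 by omega, pow_succ', hC, hinv]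
    rw [mul_right_comm, pow_mul, this, one_pow]

theorem cmat_pow_two_mul_prime {p : ℕ} [Fact p.Prime] (hp : Odd p) {x : ZMod p}
    (hx : x ^ 2 - 4 = 0) : cmat x ^ (2 * p) = 1 := by
  have h2 : (2 : ZMod p) ≠ 0 := ZMod.two_ne_zero_of_odd hp
  have hp2 : p / 2 ≠ 0 := by
    have := (Fact.out : p.Prime).two_le
    omega
  have hF := two_smul_cmat_pow_prime hp x
  rw [hx, zero_pow hp2, zero_smul, add_zero] at hF
  have h4 := congrArg (· ^ 2) hF
  simp only [_root_.smul_pow, one_pow, sub_eq_zero.mp hx, ← pow_mul, mul_comm p 2] at h4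
  refine smul_right_injective _ (pow_ne_zero 2 h2) ?_
  simp only [h4]
  norm_num

theorem PadicInt.norm_le_inv_iff_toZMod_eq_zero {p : ℕ} [Fact p.Prime] (a : ℤ_[p]) :
    ‖a‖ ≤ (p : ℝ)⁻¹ ↔ PadicInt.toZMod a = 0 := by
  rw [← RingHom.mem_ker, PadicInt.ker_toZMod, PadicInt.maximalIdeal_eq_span_p]
  simpa using PadicInt.norm_le_pow_iff_mem_span_pow a 1

theorem PadicInt.norm_eq_one_iff_toZMod_ne_zero {p : ℕ} [Fact p.Prime] (a : ℤ_[p]) :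
    ‖a‖ = 1 ↔ PadicInt.toZMod a ≠ 0 := by
  rw [Ne, ← RingHom.mem_ker, PadicInt.ker_toZMod, IsLocalRing.mem_maximalIdeal, mem_nonunits_iff,
    not_not, PadicInt.isUnit_iff]

theorem dist_vieta_iterate_le {p : ℕ} [Fact p.Prime] {n : ℕ} {x : ℤ_[p]}
    (h : cmat (PadicInt.toZMod x) ^ (2 * n) = 1) (y z : ℤ_[p]) :
    dist ((⇑(vietaSy ℤ_[p]) ∘ ⇑(vietaSz ℤ_[p]))^[n] (x, y, z)) (x, y, z) ≤ (p : ℝ)⁻¹ := by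
  obtain ⟨y', z', hit, hvec⟩ := vietaSy_comp_vietaSz_iterate PadicInt.toZMod n x y z
  rw [h, Matrix.one_mulVec] at hvec
  have hy := congrFun hvec 0
  have hz := congrFun hvec 1
  simp only [Matrix.cons_val_zero, Matrix.cons_val_one] at hy hz
  rw [hit, Prod.dist_eq, Prod.dist_eq]
  simp only [dist_self, dist_eq_norm, max_le_iff, PadicInt.norm_le_inv_iff_toZMod_eq_zero, map_sub,
    hy, hz, sub_self, and_self, and_true]
  positivity

/-- (a) If `p` is an odd prime and `x₀ ≢ ±2 (mod p)`, then applying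
`s_y ∘ s_z` exactly `(p² - 1)/4` times moves `(x₀, y₀, z₀)` a distance at most `p⁻¹`.
(b) If `p > 3` and `x₀ ≡ ±2 (mod p)`, then applying `s_y ∘ s_z` exactly `p` times moves
`(x₀, y₀, z₀)` a distance at most `p⁻¹`. -/
theorem stmt13 (p : ℕ) [Fact p.Prime] (x₀ y₀ z₀ : ℤ_[p]) :
    (Odd p → ‖x₀ - 2‖ = 1 → ‖x₀ + 2‖ = 1 →
      dist ((⇑(vietaSy ℤ_[p]) ∘ ⇑(vietaSz ℤ_[p]))^[(p ^ 2 - 1) / 4] (x₀, y₀, z₀))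
        (x₀, y₀, z₀) ≤ ((p : ℝ))⁻¹) ∧
    (3 < p → (‖x₀ - 2‖ ≤ ((p : ℝ))⁻¹ ∨ ‖x₀ + 2‖ ≤ ((p : ℝ))⁻¹) →
      dist ((⇑(vietaSy ℤ_[p]) ∘ ⇑(vietaSz ℤ_[p]))^[p] (x₀, y₀, z₀))
        (x₀, y₀, z₀) ≤ ((p : ℝ))⁻¹) := by
  have hfac : PadicInt.toZMod x₀ ^ 2 - 4 =
      PadicInt.toZMod (x₀ - 2) * PadicInt.toZMod (x₀ + 2) := by
    simp only [map_sub, map_add, map_ofNat]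
    ring
  refine ⟨fun hp h₁ h₂ => dist_vieta_iterate_le (cmat_pow_eq_one hp ?_) y₀ z₀,
    fun hp h => dist_vieta_iterate_le (cmat_pow_two_mul_prime ?_ ?_) y₀ z₀⟩
  · rw [hfac]
    exact mul_ne_zero ((PadicInt.norm_eq_one_iff_toZMod_ne_zero _).mp h₁)
      ((PadicInt.norm_eq_one_iff_toZMod_ne_zero _).mp h₂)
  · exact (Fact.out : p.Prime).odd_of_ne_two (by omega)
  · rw [hfac, mul_eq_zero]
    simpa only [PadicInt.norm_le_inv_iff_toZMod_eq_zero] using h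
end
end

section
/- Let p be a prime with p ≡ 3 (mod 4). Then the number of triples (x, y, z) ∈ (ℤ/pℤ)³ satisfying x² + y² + z² = xyz and such that at least one of 2x − yz, 2y − xz, 2z − xy is nonzero, equals p(p − 3). -/
open Polynomial

noncomputable section

section CountingSolutions

open Finset

variable {p : ℕ} [Fact p.Prime]

theorem ZMod.eq_zero_of_sq_add_sq_eq_zero (hp : p % 4 = 3) {x y : ZMod p}
    (h : x ^ 2 + y ^ 2 = 0) : x = 0 ∧ y = 0 := by
  have hy : y = 0 := by
    by_contra hy
    exact ZMod.mod_four_ne_three_of_sq_eq_neg_sq' hy (eq_neg_of_add_eq_zero_left h) hp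
  exact ⟨by simpa [hy] using h, hy⟩

/-- Over a prime field, the number of representations of `a ≠ 0` as a sum of two squares does not
depend on `a`. -/
theorem ZMod.card_sq_add_sq_eq_const {a b : ZMod p} (ha : a ≠ 0) (hb : b ≠ 0) :
    #{v : ZMod p × ZMod p | v.1 ^ 2 + v.2 ^ 2 = a} =
      #{v : ZMod p × ZMod p | v.1 ^ 2 + v.2 ^ 2 = b} := by
  have key : ∀ {a b : ZMod p}, a ≠ 0 → b ≠ 0 →
      #{v : ZMod p × ZMod p | v.1 ^ 2 + v.2 ^ 2 = a} ≤
        #{v : ZMod p × ZMod p | v.1 ^ 2 + v.2 ^ 2 = b} := by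
    intro a b ha hb
    obtain ⟨c, d, hcd⟩ := ZMod.sq_add_sq p (b / a)
    have hne : c ^ 2 + d ^ 2 ≠ 0 := hcd ▸ div_ne_zero hb ha
    rw [eq_div_iff ha] at hcd
    refine card_le_card_of_injOn (fun v ↦ (c * v.1 - d * v.2, c * v.2 + d * v.1)) ?_ ?_
    · rintro ⟨x, y⟩ h
      simp only [coe_filter, mem_univ, true_and, Set.mem_ofPred_eq] at h ⊢
      linear_combination hcd + (c ^ 2 + d ^ 2) * h
    · rintro ⟨x, y⟩ - ⟨z, w⟩ - h
      simp only [Prod.mk.injEq] at h ⊢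
      exact ⟨mul_left_cancel₀ hne (by linear_combination c * h.1 + d * h.2),
        mul_left_cancel₀ hne (by linear_combination c * h.2 - d * h.1)⟩
  exact (key ha hb).antisymm (key hb ha)

theorem ZMod.card_sq_add_sq_eq (hp : p % 4 = 3) {a : ZMod p} (ha : a ≠ 0) :
    #{v : ZMod p × ZMod p | v.1 ^ 2 + v.2 ^ 2 = a} = p + 1 := by
  have hzero : #{v : ZMod p × ZMod p | v.1 ^ 2 + v.2 ^ 2 = 0} = 1 := by
    rw [card_eq_one]
    refine ⟨0, ?_⟩
    ext ⟨x, y⟩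
    simp only [mem_filter, mem_univ, true_and, mem_singleton, Prod.mk_eq_zero]
    exact ⟨ZMod.eq_zero_of_sq_add_sq_eq_zero hp, fun h ↦ by simp [h]⟩
  have hsum := card_eq_sum_card_fiberwise (s := (univ : Finset (ZMod p × ZMod p))) (t := univ)
    (f := fun v ↦ v.1 ^ 2 + v.2 ^ 2) (fun _ _ ↦ by simp)
  rw [← add_sum_erase _ _ (mem_univ 0), hzero,
    sum_congr rfl fun b hb ↦ ZMod.card_sq_add_sq_eq_const (ne_of_mem_erase hb) ha] at hsum
  simp only [card_univ, Fintype.card_prod, ZMod.card, sum_const, card_erase_of_mem, mem_univ,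
    smul_eq_mul] at hsum
  obtain ⟨k, rfl⟩ : ∃ k, p = k + 2 := ⟨p - 2, by omega⟩
  rw [show k + 2 - 1 = k + 1 from rfl] at hsum
  exact Nat.eq_of_mul_eq_mul_left k.succ_pos (by simp only [Nat.succ_eq_add_one]; linarith)

theorem ZMod.card_one_add_sq_add_sq_ne_zero (hp : p % 4 = 3) :
    #{v : ZMod p × ZMod p | (v.1 ≠ 0 ∧ v.2 ≠ 0) ∧ 1 + v.1 ^ 2 + v.2 ^ 2 ≠ 0} = p * (p - 3) := by
  have htotal : #{v : ZMod p × ZMod p | v.1 ≠ 0 ∧ v.2 ≠ 0} = (p - 1) * (p - 1) := by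
    rw [← univ_product_univ, filter_product (· ≠ 0) (· ≠ 0), card_product]
    simp [filter_ne', ZMod.card]
  have hcircle : #{v : ZMod p × ZMod p | (v.1 ≠ 0 ∧ v.2 ≠ 0) ∧ ¬ 1 + v.1 ^ 2 + v.2 ^ 2 ≠ 0} =
      p + 1 := by
    rw [← ZMod.card_sq_add_sq_eq hp (neg_ne_zero.mpr (one_ne_zero (α := ZMod p)))]
    congr 1
    ext ⟨x, y⟩
    simp only [mem_filter, mem_univ, true_and, not_not]
    refine ⟨fun h ↦ by linear_combination h.2, fun h ↦ ⟨⟨?_, ?_⟩, by linear_combination h⟩⟩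
    · rintro rfl
      exact one_ne_zero (ZMod.eq_zero_of_sq_add_sq_eq_zero hp
        (x := 1) (y := y) (by linear_combination h)).1
    · rintro rfl
      exact one_ne_zero (ZMod.eq_zero_of_sq_add_sq_eq_zero hp
        (x := 1) (y := x) (by linear_combination h)).1
  have hsplit := card_filter_add_card_filter_not
    (s := ({v : ZMod p × ZMod p | v.1 ≠ 0 ∧ v.2 ≠ 0} : Finset _))
    (fun v ↦ 1 + v.1 ^ 2 + v.2 ^ 2 ≠ 0)
  rw [filter_filter, filter_filter, hcircle, htotal] at hsplit
  obtain ⟨k, rfl⟩ : ∃ k, p = k + 3 := ⟨p - 3, by omega⟩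
  simp only [show k + 3 - 1 = k + 2 from rfl, Nat.add_sub_cancel] at hsplit ⊢
  linarith

theorem ZMod.ne_zero_of_markoff (hp : p % 4 = 3) {x y z : ZMod p}
    (h : x ^ 2 + y ^ 2 + z ^ 2 = x * y * z)
    (hne : 2 * x - y * z ≠ 0 ∨ 2 * y - x * z ≠ 0 ∨ 2 * z - x * y ≠ 0) :
    x ≠ 0 ∧ y ≠ 0 ∧ z ≠ 0 := by
  refine ⟨?_, ?_, ?_⟩
  · rintro rfl
    obtain ⟨rfl, rfl⟩ := ZMod.eq_zero_of_sq_add_sq_eq_zero hp (x := y) (y := z)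
      (by linear_combination h)
    simp at hne
  · rintro rfl
    obtain ⟨rfl, rfl⟩ := ZMod.eq_zero_of_sq_add_sq_eq_zero hp (x := x) (y := z)
      (by linear_combination h)
    simp at hne
  · rintro rfl
    obtain ⟨rfl, rfl⟩ := ZMod.eq_zero_of_sq_add_sq_eq_zero hp (x := x) (y := y)
      (by linear_combination h)
    simp at hne

theorem ZMod.markoff_nonsingular (hp : p % 4 = 3) {x y z : ZMod p} (hx : x ≠ 0)
    (h : x ^ 2 + y ^ 2 + z ^ 2 = x * y * z) :
    2 * x - y * z ≠ 0 ∨ 2 * y - x * z ≠ 0 ∨ 2 * z - x * y ≠ 0 := by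
  have htwo : (2 : ZMod p) ≠ 0 := Ring.two_ne_zero (by rw [ZMod.ringChar_zmod_n]; omega)
  by_contra! hs
  obtain ⟨h₁, h₂, h₃⟩ := hs
  have hsq : x ^ 2 = 0 := mul_left_cancel₀ htwo (by linear_combination 2 * h - y * h₂ - z * h₃)
  exact hx (by simpa using hsq)

end CountingSolutions

/-- For a prime `p ≡ 3 (mod 4)`, the number of points of
`X_0^*(ℤ/pℤ)` is `p(p - 3)`. -/
theorem stmt14 (p : ℕ) [Fact p.Prime] (hp : p % 4 = 3) :
    Set.ncard {v : ZMod p × ZMod p × ZMod p |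
      v.1 ^ 2 + v.2.1 ^ 2 + v.2.2 ^ 2 = v.1 * v.2.1 * v.2.2 ∧
      (2 * v.1 - v.2.1 * v.2.2 ≠ 0 ∨ 2 * v.2.1 - v.1 * v.2.2 ≠ 0 ∨
        2 * v.2.2 - v.1 * v.2.1 ≠ 0)} = p * (p - 3) := by
  rw [← ZMod.card_one_add_sq_add_sq_ne_zero hp, ← Set.ncard_coe_finset]
  refine Set.ncard_congr (fun v _ ↦ (v.2.1 / v.1, v.2.2 / v.1)) ?_ ?_ ?_
  · rintro ⟨x, y, z⟩ ⟨h, hne⟩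
    obtain ⟨hx, hy, hz⟩ : x ≠ 0 ∧ y ≠ 0 ∧ z ≠ 0 := ZMod.ne_zero_of_markoff hp h hne
    simp only [Finset.coe_filter, Finset.mem_univ, true_and, Set.mem_ofPred_eq] at h ⊢
    refine ⟨⟨div_ne_zero hy hx, div_ne_zero hz hx⟩, ?_⟩
    have : 1 + (y / x) ^ 2 + (z / x) ^ 2 = y * z / x := by
      field_simp
      linear_combination h
    rw [this]
    exact div_ne_zero (mul_ne_zero hy hz) hx
  · rintro ⟨x, y, z⟩ ⟨a, b, c⟩ ⟨h, hne⟩ ⟨h', hne'⟩ heq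
    obtain ⟨hx, hy, hz⟩ : x ≠ 0 ∧ y ≠ 0 ∧ z ≠ 0 := ZMod.ne_zero_of_markoff hp h hne
    obtain ⟨ha, -, -⟩ : a ≠ 0 ∧ b ≠ 0 ∧ c ≠ 0 := ZMod.ne_zero_of_markoff hp h' hne'
    simp only [Prod.mk.injEq] at h h' heq ⊢
    obtain ⟨u, rfl⟩ : ∃ u, y = u * x := ⟨y / x, by field_simp⟩
    obtain ⟨v, rfl⟩ : ∃ v, z = v * x := ⟨z / x, by field_simp⟩
    rw [mul_div_cancel_right₀ _ hx, mul_div_cancel_right₀ _ hx, eq_div_iff ha,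
      eq_div_iff ha] at heq
    obtain ⟨rfl, rfl⟩ := heq
    have hu := left_ne_zero_of_mul hy
    have hv := left_ne_zero_of_mul hz
    have hxa : x = a := by
      have e₁ : 1 + u ^ 2 + v ^ 2 = x * (u * v) :=
        mul_left_cancel₀ (pow_ne_zero 2 hx) (by linear_combination h)
      have e₂ : 1 + u ^ 2 + v ^ 2 = a * (u * v) :=
        mul_left_cancel₀ (pow_ne_zero 2 ha) (by linear_combination h')
      exact mul_right_cancel₀ (mul_ne_zero hu hv) (e₁.symm.trans e₂)
    simp [hxa]
  · rintro ⟨u, v⟩ h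
    simp only [Finset.coe_filter, Finset.mem_univ, true_and, Set.mem_ofPred_eq] at h
    obtain ⟨⟨hu, hv⟩, hne⟩ := h
    obtain ⟨x, hx⟩ : ∃ x, x * (u * v) = 1 + u ^ 2 + v ^ 2 :=
      ⟨_, div_mul_cancel₀ _ (mul_ne_zero hu hv)⟩
    have hx₀ : x ≠ 0 := left_ne_zero_of_mul (hx ▸ hne)
    have h : x ^ 2 + (u * x) ^ 2 + (v * x) ^ 2 = x * (u * x) * (v * x) := by
      linear_combination -x ^ 2 * hx
    exact ⟨(x, u * x, v * x), ⟨h, ZMod.markoff_nonsingular hp hx₀ h⟩, by simp [hx₀]⟩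
end
end

section
/- Let p > 3 be a prime with p ≡ 3 (mod 4) and let k ≥ 1 be a natural number. Let Γ be the subgroup of permutations of (ℤ/p^kℤ)³ generated by the three Vieta involutions (x,y,z) ↦ (yz−x,y,z), (x,y,z) ↦ (x,xz−y,z), (x,y,z) ↦ (x,y,xy−z). Then for every point s ∈ X_0^*(ℤ/p^kℤ), the cardinality of the Γ-orbit of s is divisible by p^k. -/
open Polynomial

noncomputable section

theorem ZMod.isUnit_iff_castHom_ne_zero {p k : ℕ} [Fact p.Prime] (hk : 1 ≤ k)
    (a : ZMod (p ^ k)) :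
    IsUnit a ↔ ZMod.castHom (dvd_pow_self p (by omega : k ≠ 0)) (ZMod p) a ≠ 0 := by
  obtain ⟨n, rfl⟩ := ZMod.natCast_zmod_surjective a
  have hp := Fact.out (p := p.Prime)
  rw [ZMod.isUnit_iff_coprime, map_natCast, Ne, ZMod.natCast_eq_zero_iff,
    Nat.coprime_pow_right_iff (by omega), Nat.coprime_comm, hp.coprime_iff_not_dvd]

/-- If `-1` is not a square modulo `p`, a zero coordinate of a point of
`x² + y² + z² = xyz` over `ZMod p` forces the other two to vanish. -/
theorem ZMod.eq_zero_of_markoff {p : ℕ} [Fact p.Prime] (hp4 : p % 4 = 3) {x y z : ZMod p}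
    (h : x ^ 2 + y ^ 2 + z ^ 2 - x * y * z = 0) (hx : x = 0) : y = 0 ∧ z = 0 := by
  subst hx
  have key : ∀ a b : ZMod p, a ^ 2 + b ^ 2 = 0 → a = 0 := by
    intro a b hab
    by_contra ha
    exact ZMod.mod_four_ne_three_of_sq_eq_neg_sq' (p := p) (x := b) (y := a) ha
      (by linear_combination hab) hp4
  exact ⟨key y z (by linear_combination h), key z y (by linear_combination h)⟩

/-- The points of the Markoff surface `x² + y² + z² = xyz` all of whose coordinates are units. -/
def markoffUnits (R : Type*) [CommRing R] : Set (R × R × R) :=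
  {v | v.1 ^ 2 + v.2.1 ^ 2 + v.2.2 ^ 2 - v.1 * v.2.1 * v.2.2 = 0 ∧
    IsUnit v.1 ∧ IsUnit v.2.1 ∧ IsUnit v.2.2}

theorem mem_markoffUnits_of_isUnit {p k : ℕ} [Fact p.Prime] (hp4 : p % 4 = 3) (hk : 1 ≤ k)
    {x y z : ZMod (p ^ k)} (h : x ^ 2 + y ^ 2 + z ^ 2 - x * y * z = 0)
    (hu : IsUnit x ∨ IsUnit y ∨ IsUnit z) : (x, y, z) ∈ markoffUnits (ZMod (p ^ k)) := by
  refine ⟨h, ?_⟩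
  simp only [ZMod.isUnit_iff_castHom_ne_zero hk] at hu ⊢
  have h' := congrArg (ZMod.castHom (dvd_pow_self p (by omega : k ≠ 0)) (ZMod p)) h
  simp only [map_sub, map_add, map_mul, map_pow, map_zero] at h'
  generalize ZMod.castHom _ (ZMod p) x = a at *
  generalize ZMod.castHom _ (ZMod p) y = b at *
  generalize ZMod.castHom _ (ZMod p) z = c at *
  have h1 := ZMod.eq_zero_of_markoff hp4 (x := a) (y := b) (z := c) h'
  have h2 := ZMod.eq_zero_of_markoff hp4 (x := b) (y := a) (z := c) (by linear_combination h')
  have h3 := ZMod.eq_zero_of_markoff hp4 (x := c) (y := a) (z := b) (by linear_combination h')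
  tauto

theorem markoffSet_zero_subset_markoffUnits {p k : ℕ} [Fact p.Prime] (hp4 : p % 4 = 3)
    (hk : 1 ≤ k) : markoffSet (ZMod (p ^ k)) 0 ⊆ markoffUnits (ZMod (p ^ k)) := by
  rintro ⟨x, y, z⟩ ⟨h, hu⟩
  refine mem_markoffUnits_of_isUnit hp4 hk h ?_
  simp only [ZMod.isUnit_iff_castHom_ne_zero hk, map_sub, map_mul] at hu ⊢
  by_contra! hc
  simp [hc.1, hc.2.1, hc.2.2] at hu

theorem smul_mem_markoffUnits {p k : ℕ} [Fact p.Prime] (hp4 : p % 4 = 3) (hk : 1 ≤ k)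
    (g : vietaGroup (ZMod (p ^ k))) {v : ZMod (p ^ k) × ZMod (p ^ k) × ZMod (p ^ k)}
    (hv : v ∈ markoffUnits (ZMod (p ^ k))) : g • v ∈ markoffUnits (ZMod (p ^ k)) := by
  obtain ⟨g, hg⟩ := g
  rw [Subgroup.mk_smul, Equiv.Perm.smul_def]
  have step : ∀ g ∈ ({vietaSx _, vietaSy _, vietaSz _} : Set (Equiv.Perm (_ × _ × _))),
      ∀ v ∈ markoffUnits (ZMod (p ^ k)), g v ∈ markoffUnits (ZMod (p ^ k)) := by
    rintro g (rfl | rfl | rfl) ⟨x, y, z⟩ ⟨h, hx, hy, hz⟩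
    · exact mem_markoffUnits_of_isUnit hp4 hk (by linear_combination h) (.inr (.inl hy))
    · exact mem_markoffUnits_of_isUnit hp4 hk (by linear_combination h) (.inl hx)
    · exact mem_markoffUnits_of_isUnit hp4 hk (by linear_combination h) (.inl hx)
  induction hg using Subgroup.closure_induction generalizing v with
  | mem g hg => exact step g hg v hv
  | one => exact hv
  | mul a b _ _ iha ihb => exact iha (ihb hv)
  | inv a _ iha =>
    have : NeZero (p ^ k) := ⟨pow_ne_zero _ (Fact.out (p := p.Prime)).ne_zero⟩
    obtain ⟨w, hw, rfl⟩ := (((Set.toFinite _).injOn_iff_bijOn_of_mapsTo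
      (fun _ h => iha h)).mp a.injective.injOn).surjOn hv
    simpa using hw

/-- A function that an element of the group negates on an orbit has orbit sum zero, if `2` is
a unit. -/
theorem sum_orbit_eq_zero_of_smul_eq_neg {G α R : Type*} [Group G] [MulAction G α] [CommRing R]
    (h2 : IsUnit (2 : R)) (s : α) [Fintype (MulAction.orbit G s)] (f : α → R) (g : G)
    (hf : ∀ v ∈ MulAction.orbit G s, f (g • v) = -f v) :
    ∑ v : MulAction.orbit G s, f v = 0 := by
  have h : ∑ v : MulAction.orbit G s, f v = ∑ v : MulAction.orbit G s, -f v :=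
    (Equiv.sum_comp (MulAction.toPerm g) fun v : MulAction.orbit G s => f v).symm.trans
      (Finset.sum_congr rfl fun v _ => hf v v.2)
  rw [Finset.sum_neg_distrib] at h
  exact h2.mul_right_eq_zero.mp (by linear_combination h)

/-- D. Martin / W. Chen. For a prime `p > 3` with `p ≡ 3 (mod 4)`
and `k ≥ 1`, every orbit of the Vieta group `Γ` on `X_0^*(ℤ/p^kℤ)` has cardinality
divisible by `p^k`. -/
theorem stmt15 (p : ℕ) [Fact p.Prime] (hp : 3 < p) (hp4 : p % 4 = 3) (k : ℕ) (hk : 1 ≤ k)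
    (s : ZMod (p ^ k) × ZMod (p ^ k) × ZMod (p ^ k))
    (hs : s ∈ markoffSet (ZMod (p ^ k)) 0) :
    p ^ k ∣ Nat.card (MulAction.orbit (vietaGroup (ZMod (p ^ k))) s) := by
  have : NeZero (p ^ k) := ⟨pow_ne_zero _ (Fact.out (p := p.Prime)).ne_zero⟩
  have h2 : IsUnit (2 : ZMod (p ^ k)) := by
    have := (ZMod.isUnit_iff_coprime 2 (p ^ k)).mpr
      (Nat.Coprime.pow_right k ((Nat.coprime_primes Nat.prime_two Fact.out).mpr (by omega)))
    exact_mod_cast this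
  have hunits : ∀ v ∈ MulAction.orbit (vietaGroup (ZMod (p ^ k))) s,
      v ∈ markoffUnits (ZMod (p ^ k)) := by
    rintro _ ⟨g, rfl⟩
    exact smul_mem_markoffUnits hp4 hk g (markoffSet_zero_subset_markoffUnits hp4 hk hs)
  have := Fintype.ofFinite (MulAction.orbit (vietaGroup (ZMod (p ^ k))) s)
  have hx := sum_orbit_eq_zero_of_smul_eq_neg h2 s
    (fun v => 2 * (v.1 * Ring.inverse v.2.1 * Ring.inverse v.2.2) - 1)
    (⟨vietaSx _, Subgroup.subset_closure (by simp)⟩ : vietaGroup (ZMod (p ^ k))) (by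
      intro v hv
      obtain ⟨-, -, hy, hz⟩ := hunits v hv
      have hy := Ring.mul_inverse_cancel _ hy
      have hz := Ring.mul_inverse_cancel _ hz
      change 2 * ((v.2.1 * v.2.2 - v.1) * Ring.inverse v.2.1 * Ring.inverse v.2.2) - 1 = _
      linear_combination 2 * v.2.2 * Ring.inverse v.2.2 * hy + 2 * hz)
  have hy := sum_orbit_eq_zero_of_smul_eq_neg h2 s
    (fun v => 2 * (v.2.1 * Ring.inverse v.1 * Ring.inverse v.2.2) - 1)
    (⟨vietaSy _, Subgroup.subset_closure (by simp)⟩ : vietaGroup (ZMod (p ^ k))) (by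
      intro v hv
      obtain ⟨-, hx, -, hz⟩ := hunits v hv
      have hx := Ring.mul_inverse_cancel _ hx
      have hz := Ring.mul_inverse_cancel _ hz
      change 2 * ((v.1 * v.2.2 - v.2.1) * Ring.inverse v.1 * Ring.inverse v.2.2) - 1 = _
      linear_combination 2 * v.2.2 * Ring.inverse v.2.2 * hx + 2 * hz)
  have hz := sum_orbit_eq_zero_of_smul_eq_neg h2 s
    (fun v => 2 * (v.2.2 * Ring.inverse v.1 * Ring.inverse v.2.1) - 1)
    (⟨vietaSz _, Subgroup.subset_closure (by simp)⟩ : vietaGroup (ZMod (p ^ k))) (by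
      intro v hv
      obtain ⟨-, hx, hy, -⟩ := hunits v hv
      have hx := Ring.mul_inverse_cancel _ hx
      have hy := Ring.mul_inverse_cancel _ hy
      change 2 * ((v.1 * v.2.1 - v.2.2) * Ring.inverse v.1 * Ring.inverse v.2.1) - 1 = _
      linear_combination 2 * v.2.1 * Ring.inverse v.2.1 * hx + 2 * hy)
  have hsum := congrArg₂ (· + ·) (congrArg₂ (· + ·) hx hy) hz
  simp only [← Finset.sum_add_distrib, add_zero] at hsum
  rw [Finset.sum_congr rfl (g := fun _ => (-1 : ZMod (p ^ k)))] at hsum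
  · rw [← ZMod.natCast_eq_zero_iff, Nat.card_eq_fintype_card]
    simpa using hsum
  · rintro ⟨⟨x, y, z⟩, hv⟩ -
    obtain ⟨h, hx, hy, hz⟩ := hunits _ hv
    have ex := Ring.mul_inverse_cancel _ hx
    have ey := Ring.mul_inverse_cancel _ hy
    have ez := Ring.mul_inverse_cancel _ hz
    dsimp only at h ex ey ez ⊢
    apply (hx.mul (hy.mul hz)).mul_left_cancel
    generalize Ring.inverse x = a at *
    generalize Ring.inverse y = b at *
    generalize Ring.inverse z = c at *
    linear_combination 2 * h + 2 * x ^ 2 * (y * b * ez + ey) + 2 * y ^ 2 * (x * a * ez + ex) +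
      2 * z ^ 2 * (x * a * ey + ex)
end
end

section
/- Let p > 3 be a prime and let D ∈ ℤ_p be such that |D|_p ≤ p⁻² and there is no nonzero t ∈ ℤ/pℤ with t² equal to the image of D − 4 in ℤ/pℤ. Then for every point q ∈ X_D^*(ℤ_p) there exists γ in the group Γ generated by the Vieta involutions such that dist(q, γ(q)) = p⁻¹. -/
open Polynomial

noncomputable section

@[simp]
theorem vietaSx_apply {R : Type*} [CommRing R] (v : R × R × R) :
    vietaSx R v = (v.2.1 * v.2.2 - v.1, v.2.1, v.2.2) := rfl

@[simp]
theorem vietaSy_apply {R : Type*} [CommRing R] (v : R × R × R) :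
    vietaSy R v = (v.1, v.1 * v.2.2 - v.2.1, v.2.2) := rfl

@[simp]
theorem vietaSz_apply {R : Type*} [CommRing R] (v : R × R × R) :
    vietaSz R v = (v.1, v.2.1, v.1 * v.2.1 - v.2.2) := rfl

/-- A finite set of triples with unit coordinates on `x² + y² + z² = xyz` which is stable under the
Vieta involutions has cardinality zero in the base ring. -/
theorem card_eq_zero_of_vieta_stable {R : Type*} [CommRing R] (O : Finset (R × R × R))
    (hx : ∀ v ∈ O, vietaSx R v ∈ O) (hy : ∀ v ∈ O, vietaSy R v ∈ O)
    (hz : ∀ v ∈ O, vietaSz R v ∈ O)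
    (hO : ∀ v ∈ O, v.1 ^ 2 + v.2.1 ^ 2 + v.2.2 ^ 2 = v.1 * v.2.1 * v.2.2)
    (hu : ∀ v ∈ O, IsUnit v.1 ∧ IsUnit v.2.1 ∧ IsUnit v.2.2) : (O.card : R) = 0 := by
  have double_sum (s : Equiv.Perm (R × R × R)) (hs : ∀ v ∈ O, s v ∈ O)
      (hinv : ∀ v, s (s v) = v) (f : R × R × R → R) (hf : ∀ v ∈ O, f v + f (s v) = 1) :
      2 * ∑ v ∈ O, f v = O.card := by
    have h : ∑ v ∈ O, f (s v) = ∑ v ∈ O, f v :=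
      Finset.sum_bij' (fun v _ => s v) (fun v _ => s v) hs hs (fun v _ => hinv v)
        (fun v _ => hinv v) (fun v _ => rfl)
    rw [two_mul]
    nth_rewrite 2 [← h]
    rw [← Finset.sum_add_distrib, Finset.sum_congr rfl hf]
    simp
  have hX := double_sum (vietaSx R) hx (by rintro ⟨x, y, z⟩; simp)
    (fun v => v.1 * (Ring.inverse v.2.1 * Ring.inverse v.2.2)) (by
      rintro ⟨x, y, z⟩ hv
      obtain ⟨-, h2, h3⟩ := hu _ hv
      have e2 := Ring.mul_inverse_cancel _ h2
      have e3 := Ring.mul_inverse_cancel _ h3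
      simp only [vietaSx_apply]
      linear_combination z * Ring.inverse z * e2 + e3)
  have hY := double_sum (vietaSy R) hy (by rintro ⟨x, y, z⟩; simp)
    (fun v => v.2.1 * (Ring.inverse v.1 * Ring.inverse v.2.2)) (by
      rintro ⟨x, y, z⟩ hv
      obtain ⟨h1, -, h3⟩ := hu _ hv
      have e1 := Ring.mul_inverse_cancel _ h1
      have e3 := Ring.mul_inverse_cancel _ h3
      simp only [vietaSy_apply]
      linear_combination z * Ring.inverse z * e1 + e3)
  have hZ := double_sum (vietaSz R) hz (by rintro ⟨x, y, z⟩; simp)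
    (fun v => v.2.2 * (Ring.inverse v.1 * Ring.inverse v.2.1)) (by
      rintro ⟨x, y, z⟩ hv
      obtain ⟨h1, h2, -⟩ := hu _ hv
      have e1 := Ring.mul_inverse_cancel _ h1
      have e2 := Ring.mul_inverse_cancel _ h2
      simp only [vietaSz_apply]
      linear_combination y * Ring.inverse y * e1 + e2)
  have hsum : ∑ v ∈ O, (v.1 * (Ring.inverse v.2.1 * Ring.inverse v.2.2) +
      v.2.1 * (Ring.inverse v.1 * Ring.inverse v.2.2) +
      v.2.2 * (Ring.inverse v.1 * Ring.inverse v.2.1)) = ∑ v ∈ O, (1 : R) := by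
    refine Finset.sum_congr rfl ?_
    rintro ⟨x, y, z⟩ hv
    obtain ⟨h1, h2, h3⟩ := hu _ hv
    have e1 := Ring.mul_inverse_cancel _ h1
    have e2 := Ring.mul_inverse_cancel _ h2
    have e3 := Ring.mul_inverse_cancel _ h3
    have h := hO _ hv
    refine (h1.mul (h2.mul h3)).mul_left_cancel ?_
    simp only at *
    linear_combination h + x ^ 2 * (y * Ring.inverse y * e3 + e2) +
      y ^ 2 * (x * Ring.inverse x * e3 + e1) + z ^ 2 * (x * Ring.inverse x * e2 + e1)
  simp only [Finset.sum_add_distrib, Finset.sum_const, nsmul_eq_mul, mul_one] at hsum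
  linear_combination 2 * hsum - hX - hY - hZ

/-- A point of `x² + y² + z² = xyz` with nonzero coordinates is determined by its ratios
`y / x` and `z / x`. -/
theorem card_lt_of_markoff {F : Type*} [Field F] [Fintype F] (O : Finset (F × F × F))
    (hO : ∀ v ∈ O, v.1 ^ 2 + v.2.1 ^ 2 + v.2.2 ^ 2 = v.1 * v.2.1 * v.2.2)
    (h0 : ∀ v ∈ O, v.1 ≠ 0 ∧ v.2.1 ≠ 0 ∧ v.2.2 ≠ 0) : O.card < Fintype.card F ^ 2 := by
  classical
  let T : Finset (F × F) := Finset.univ.erase (0, 0)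
  have hT : T.card < Fintype.card F ^ 2 := by
    rw [sq, ← Fintype.card_prod, ← Finset.card_univ]
    exact Finset.card_erase_lt_of_mem (Finset.mem_univ _)
  refine lt_of_le_of_lt (Finset.card_le_card_of_injOn
    (fun v => (v.2.1 / v.1, v.2.2 / v.1)) ?_ ?_) hT
  · intro v hv
    obtain ⟨h1, h2, h3⟩ := h0 v hv
    simp [T, h1, h2]
  · have scale : ∀ v ∈ O, 1 + (v.2.1 / v.1) ^ 2 + (v.2.2 / v.1) ^ 2 =
        v.1 * ((v.2.1 / v.1) * (v.2.2 / v.1)) := by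
      intro v hv
      obtain ⟨h1, h2, h3⟩ := h0 v hv
      field_simp
      linear_combination hO v hv
    rintro ⟨x, y, z⟩ hv ⟨x', y', z'⟩ hv' heq
    obtain ⟨h1, h2, h3⟩ := h0 _ hv
    obtain ⟨h1', h2', h3'⟩ := h0 _ hv'
    have s := scale _ hv
    have s' := scale _ hv'
    simp only [Prod.mk.injEq] at *
    obtain ⟨ha, hb⟩ := heq
    rw [← ha, ← hb, s] at s'
    have hxx : x = x' := mul_right_cancel₀ (by positivity) s'
    subst hxx
    exact ⟨rfl, (div_left_inj' h1).1 ha, (div_left_inj' h1).1 hb⟩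

/-- Coordinatewise application of a ring homomorphism to triples. -/
def mapTriple {R S : Type*} [CommRing R] [CommRing S] (f : R →+* S) (v : R × R × R) : S × S × S :=
  (f v.1, f v.2.1, f v.2.2)

theorem mapTriple_vietaSx {R S : Type*} [CommRing R] [CommRing S] (f : R →+* S) (v : R × R × R) :
    mapTriple f (vietaSx R v) = vietaSx S (mapTriple f v) := by
  simp [mapTriple]

theorem mapTriple_vietaSy {R S : Type*} [CommRing R] [CommRing S] (f : R →+* S) (v : R × R × R) :
    mapTriple f (vietaSy R v) = vietaSy S (mapTriple f v) := by
  simp [mapTriple]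

theorem mapTriple_vietaSz {R S : Type*} [CommRing R] [CommRing S] (f : R →+* S) (v : R × R × R) :
    mapTriple f (vietaSz R v) = vietaSz S (mapTriple f v) := by
  simp [mapTriple]

/-- Elements of the Vieta group descend along ring homomorphisms. -/
theorem exists_mapTriple_comm {R S : Type*} [CommRing R] [CommRing S] (f : R →+* S)
    {γ : Equiv.Perm (R × R × R)} (hγ : γ ∈ vietaGroup R) :
    ∃ δ : Equiv.Perm (S × S × S), ∀ v, mapTriple f (γ v) = δ (mapTriple f v) := by
  induction hγ using Subgroup.closure_induction with
  | mem γ h =>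
    rcases h with rfl | rfl | rfl
    exacts [⟨_, mapTriple_vietaSx f⟩, ⟨_, mapTriple_vietaSy f⟩, ⟨_, mapTriple_vietaSz f⟩]
  | one => exact ⟨1, fun v => rfl⟩
  | mul γ₁ γ₂ _ _ h₁ h₂ =>
    obtain ⟨δ₁, h₁⟩ := h₁
    obtain ⟨δ₂, h₂⟩ := h₂
    exact ⟨δ₁ * δ₂, fun v => by simp [h₁, h₂]⟩
  | inv γ _ h =>
    obtain ⟨δ, h⟩ := h
    refine ⟨δ⁻¹, fun v => ?_⟩
    rw [Equiv.Perm.eq_inv_iff_eq, ← h, ← Equiv.Perm.mul_apply, mul_inv_cancel, Equiv.Perm.one_apply]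

theorem mapTriple_apply_eq_iff {R S : Type*} [CommRing R] [CommRing S] (f : R →+* S)
    {γ : Equiv.Perm (R × R × R)} (hγ : γ ∈ vietaGroup R) (v w : R × R × R) :
    mapTriple f (γ v) = mapTriple f (γ w) ↔ mapTriple f v = mapTriple f w := by
  obtain ⟨δ, h⟩ := exists_mapTriple_comm f hγ
  rw [h, h, δ.injective.eq_iff]

/-- The Vieta group preserves `x² + y² + z² - xyz`. -/
theorem markoff_apply_vietaGroup {R : Type*} [CommRing R]
    {γ : Equiv.Perm (R × R × R)} (hγ : γ ∈ vietaGroup R) (v : R × R × R) :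
    (γ v).1 ^ 2 + (γ v).2.1 ^ 2 + (γ v).2.2 ^ 2 - (γ v).1 * (γ v).2.1 * (γ v).2.2 =
      v.1 ^ 2 + v.2.1 ^ 2 + v.2.2 ^ 2 - v.1 * v.2.1 * v.2.2 := by
  induction hγ using Subgroup.closure_induction generalizing v with
  | mem γ h =>
    rcases h with rfl | rfl | rfl <;>
      simp only [vietaSx_apply, vietaSy_apply, vietaSz_apply] <;> ring
  | one => rfl
  | mul γ₁ γ₂ _ _ h₁ h₂ => rw [Equiv.Perm.mul_apply, h₁, h₂]
  | inv γ _ h => rw [← h (γ⁻¹ v), ← Equiv.Perm.mul_apply, mul_inv_cancel, Equiv.Perm.one_apply]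

theorem vietaGroup_apply_zero {R : Type*} [CommRing R]
    {γ : Equiv.Perm (R × R × R)} (hγ : γ ∈ vietaGroup R) : γ 0 = 0 := by
  induction hγ using Subgroup.closure_induction with
  | mem γ h => rcases h with rfl | rfl | rfl <;> simp
  | one => rfl
  | mul γ₁ γ₂ _ _ h₁ h₂ => rw [Equiv.Perm.mul_apply, h₂, h₁]
  | inv γ _ h => rw [Equiv.Perm.inv_eq_iff_eq, h]

/-- If `-4` is not a nonzero square, a nonzero solution of `x² + y² + z² = xyz` has nonzero
coordinates. -/
theorem markoff_coords_ne_zero {F : Type*} [Field F] (h2 : (2 : F) ≠ 0)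
    (h4 : ¬∃ t : F, t ≠ 0 ∧ t ^ 2 = -4) {x y z : F}
    (h : x ^ 2 + y ^ 2 + z ^ 2 = x * y * z) (h0 : ¬(x = 0 ∧ y = 0 ∧ z = 0)) :
    x ≠ 0 ∧ y ≠ 0 ∧ z ≠ 0 := by
  have sum_sq (a b : F) (hab : a ^ 2 + b ^ 2 = 0) : a = 0 ∧ b = 0 := by
    by_cases hb : b = 0
    · subst hb
      simpa using hab
    · have ha : a ≠ 0 := by
        rintro rfl
        simp [hb] at hab
      refine absurd ⟨2 * a / b, by simp [h2, ha, hb], ?_⟩ h4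
      field_simp
      linear_combination 4 * hab
  refine ⟨?_, ?_, ?_⟩ <;> rintro rfl
  · exact h0 ⟨rfl, sum_sq y z (by linear_combination h)⟩
  · obtain ⟨hx, hz⟩ := sum_sq x z (by linear_combination h)
    exact h0 ⟨hx, rfl, hz⟩
  · obtain ⟨hx, hy⟩ := sum_sq x y (by linear_combination h)
    exact h0 ⟨hx, hy, rfl⟩

theorem toZMod_eq_zero_iff_norm {p : ℕ} [Fact p.Prime] (x : ℤ_[p]) :
    PadicInt.toZMod x = 0 ↔ ‖x‖ ≤ ((p : ℝ))⁻¹ := by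
  rw [← RingHom.mem_ker, PadicInt.ker_toZMod, PadicInt.maximalIdeal_eq_span_p]
  simpa using (PadicInt.norm_le_pow_iff_mem_span_pow x 1).symm

theorem toZModPow_two_eq_zero_iff_norm {p : ℕ} [Fact p.Prime] (x : ℤ_[p]) :
    PadicInt.toZModPow 2 x = 0 ↔ ‖x‖ ≤ ((p : ℝ))⁻¹ ^ 2 := by
  rw [← RingHom.mem_ker, PadicInt.ker_toZModPow, ← PadicInt.norm_le_pow_iff_mem_span_pow]
  simp [zpow_neg]

theorem inv_sq_lt_norm_iff {p : ℕ} [Fact p.Prime] (x : ℤ_[p]) :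
    ((p : ℝ))⁻¹ ^ 2 < ‖x‖ ↔ ((p : ℝ))⁻¹ ≤ ‖x‖ := by
  have h := PadicInt.norm_le_pow_iff_norm_lt_pow_add_one x (-2)
  have e : (p : ℝ) ^ (-2 : ℤ) = (p : ℝ)⁻¹ ^ 2 := by simp [zpow_neg]
  rw [← not_le, ← e, h, not_lt]
  norm_num

theorem mapTriple_eq_iff_dist {p : ℕ} [Fact p.Prime] {S : Type*} [CommRing S] (f : ℤ_[p] →+* S)
    {r : ℝ} (hf : ∀ x, f x = 0 ↔ ‖x‖ ≤ r) (v w : ℤ_[p] × ℤ_[p] × ℤ_[p]) :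
    mapTriple f v = mapTriple f w ↔ dist v w ≤ r := by
  have key (a b : ℤ_[p]) : f a = f b ↔ dist a b ≤ r := by
    rw [dist_eq_norm, ← hf, map_sub, sub_eq_zero]
  simp [mapTriple, Prod.dist_eq, key]

/-- Triples congruent modulo `p` but not modulo `p²` lie at distance `p⁻¹`. -/
theorem dist_eq_inv_of_mapTriple {p : ℕ} [Fact p.Prime] {v w : ℤ_[p] × ℤ_[p] × ℤ_[p]}
    (h1 : mapTriple PadicInt.toZMod v = mapTriple PadicInt.toZMod w)
    (h2 : mapTriple (PadicInt.toZModPow 2) v ≠ mapTriple (PadicInt.toZModPow 2) w) :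
    dist v w = ((p : ℝ))⁻¹ := by
  rw [mapTriple_eq_iff_dist _ toZMod_eq_zero_iff_norm] at h1
  rw [Ne, mapTriple_eq_iff_dist _ toZModPow_two_eq_zero_iff_norm, not_le] at h2
  refine le_antisymm h1 ?_
  have key (a b : ℤ_[p]) : ((p : ℝ))⁻¹ ^ 2 < dist a b ↔ ((p : ℝ))⁻¹ ≤ dist a b := by
    rw [dist_eq_norm, inv_sq_lt_norm_iff]
  simpa only [Prod.dist_eq, lt_max_iff, le_max_iff, key] using h2

/-- If `p > 3` is prime, `|D|_p ≤ p⁻²` and `D - 4` is not a nonzero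
square mod `p`, then every point of `X_D^*(ℤ_p)` is moved a distance exactly `p⁻¹` by
some element of the Vieta group `Γ`. -/
theorem stmt16 (p : ℕ) [Fact p.Prime] (hp : 3 < p) (D : ℤ_[p])
    (hD : ‖D‖ ≤ ((p : ℝ))⁻¹ ^ 2)
    (hQR : ¬∃ t : ZMod p, t ≠ 0 ∧ t ^ 2 = PadicInt.toZMod (D - 4)) :
    ∀ q ∈ markoffSet ℤ_[p] D,
      ∃ γ ∈ vietaGroup ℤ_[p], dist q (γ q) = ((p : ℝ))⁻¹ := by
  classical
  intro q hq
  by_contra! hcon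
  let f : ℤ_[p] →+* ZMod p := PadicInt.toZMod
  let g : ℤ_[p] →+* ZMod (p ^ 2) := PadicInt.toZModPow 2
  have : NeZero (p ^ 2) := ⟨pow_ne_zero 2 (Fact.out : p.Prime).ne_zero⟩
  have lift_unique {γ₁ γ₂ : Equiv.Perm (ℤ_[p] × ℤ_[p] × ℤ_[p])} (h₁ : γ₁ ∈ vietaGroup ℤ_[p])
      (h₂ : γ₂ ∈ vietaGroup ℤ_[p]) (h : mapTriple f (γ₁ q) = mapTriple f (γ₂ q)) :
      mapTriple g (γ₁ q) = mapTriple g (γ₂ q) := by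
    by_contra hne
    have hmem : γ₁⁻¹ * γ₂ ∈ vietaGroup ℤ_[p] := mul_mem (inv_mem h₁) h₂
    have e : γ₂ q = γ₁ ((γ₁⁻¹ * γ₂) q) := by simp
    rw [e, mapTriple_apply_eq_iff _ h₁] at h hne
    exact hcon _ hmem (dist_eq_inv_of_mapTriple h hne)
  have hgD : g D = 0 := (toZModPow_two_eq_zero_iff_norm D).2 hD
  have hfD : f D = 0 := (toZMod_eq_zero_iff_norm D).2 (hD.trans (by
    have : (1 : ℝ) ≤ p := by exact_mod_cast (by omega : 1 ≤ p)
    exact pow_le_of_le_one (by positivity) (inv_le_one_of_one_le₀ this) two_ne_zero))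
  have h2 : (2 : ZMod p) ≠ 0 := by
    intro h
    have : p ∣ 2 := (ZMod.natCast_eq_zero_iff 2 p).1 (by exact_mod_cast h)
    have := Nat.le_of_dvd two_pos this
    omega
  have h4 : ¬∃ t : ZMod p, t ≠ 0 ∧ t ^ 2 = -4 := by
    have e : f (D - 4) = -4 := by rw [map_sub, hfD, map_ofNat, zero_sub]
    rwa [← e]
  have markoff_map {S : Type} [CommRing S] (φ : ℤ_[p] →+* S) (hφ : φ D = 0)
      {γ : Equiv.Perm (ℤ_[p] × ℤ_[p] × ℤ_[p])} (hγ : γ ∈ vietaGroup ℤ_[p]) :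
      φ (γ q).1 ^ 2 + φ (γ q).2.1 ^ 2 + φ (γ q).2.2 ^ 2 =
        φ (γ q).1 * φ (γ q).2.1 * φ (γ q).2.2 := by
    have h := congrArg φ ((markoff_apply_vietaGroup hγ q).trans hq.1)
    simp only [map_add, map_sub, map_mul, map_pow, hφ] at h
    exact sub_eq_zero.1 h
  have coords_ne {γ : Equiv.Perm (ℤ_[p] × ℤ_[p] × ℤ_[p])} (hγ : γ ∈ vietaGroup ℤ_[p]) :
      f (γ q).1 ≠ 0 ∧ f (γ q).2.1 ≠ 0 ∧ f (γ q).2.2 ≠ 0 := by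
    refine markoff_coords_ne_zero h2 h4 (markoff_map f hfD hγ) ?_
    rintro ⟨hx, hy, hz⟩
    have h0 : mapTriple f (γ q) = mapTriple f (γ 0) := by
      rw [vietaGroup_apply_zero hγ]
      simp [mapTriple, hx, hy, hz]
    rw [mapTriple_apply_eq_iff _ hγ] at h0
    simp only [mapTriple, Prod.fst_zero, Prod.snd_zero, map_zero, Prod.mk.injEq] at h0
    obtain ⟨hx, hy, hz⟩ := h0
    rcases hq.2 with hu | hu | hu <;> exact (hu.map f).ne_zero (by simp [hx, hy, hz])
  have isUnit_of_ne {x : ℤ_[p]} (hx : f x ≠ 0) : IsUnit (g x) := by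
    refine IsUnit.map g ?_
    by_contra hu
    rw [← mem_nonunits_iff, ← IsLocalRing.mem_maximalIdeal, ← PadicInt.ker_toZMod] at hu
    exact hx hu
  let A : Set (ZMod (p ^ 2) × ZMod (p ^ 2) × ZMod (p ^ 2)) :=
    {w | ∃ γ ∈ vietaGroup ℤ_[p], mapTriple g (γ q) = w}
  let O := (Set.toFinite A).toFinset
  have hmem (w) : w ∈ O ↔ ∃ γ ∈ vietaGroup ℤ_[p], mapTriple g (γ q) = w := by simp [O, A]
  have card_zero : (O.card : ZMod (p ^ 2)) = 0 := by
    refine card_eq_zero_of_vieta_stable O ?_ ?_ ?_ ?_ ?_ <;> intro w hw <;>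
      obtain ⟨γ, hγ, rfl⟩ := (hmem w).1 hw
    · exact (hmem _).2 ⟨vietaSx _ * γ, mul_mem (Subgroup.subset_closure (by simp)) hγ,
        mapTriple_vietaSx g _⟩
    · exact (hmem _).2 ⟨vietaSy _ * γ, mul_mem (Subgroup.subset_closure (by simp)) hγ,
        mapTriple_vietaSy g _⟩
    · exact (hmem _).2 ⟨vietaSz _ * γ, mul_mem (Subgroup.subset_closure (by simp)) hγ,
        mapTriple_vietaSz g _⟩
    · exact markoff_map g hgD hγ
    · obtain ⟨hx, hy, hz⟩ := coords_ne hγ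
      exact ⟨isUnit_of_ne hx, isUnit_of_ne hy, isUnit_of_ne hz⟩
  have card_pos : 0 < O.card := Finset.card_pos.2 ⟨mapTriple g q, (hmem _).2 ⟨1, one_mem _, rfl⟩⟩
  choose! σ hσ hσg using fun w => (hmem w).1
  have card_lt : (O.image fun w => mapTriple f (σ w q)).card < Fintype.card (ZMod p) ^ 2 := by
    refine card_lt_of_markoff _ ?_ ?_ <;> simp only [Finset.mem_image] <;>
      rintro _ ⟨w, hw, rfl⟩
    · exact markoff_map f hfD (hσ w hw)
    · exact coords_ne (hσ w hw)
  rw [Finset.card_image_of_injOn, ZMod.card] at card_lt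
  · exact absurd (Nat.le_of_dvd card_pos ((ZMod.natCast_eq_zero_iff _ _).1 card_zero)) card_lt.not_ge
  · intro w hw w' hw' h
    rw [← hσg w hw, ← hσg w' hw']
    exact lift_unique (hσ w hw) (hσ w' hw') h
end
end

section
/- Let p > 3 be a prime, let D ∈ ℤ_p, and let q = (x₀, y₀, z₀) ∈ X_D^*(ℤ_p) be a point such that (i) at least one of x₀, y₀, z₀ is congruent to 2 or −2 modulo p, and (ii) each of 2x₀ − y₀z₀, 2y₀ − x₀z₀, 2z₀ − x₀y₀ is a unit of ℤ_p. Then there exists γ in the group Γ generated by the Vieta involutions such that dist(q, γ(q)) = p⁻¹. -/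
open Polynomial

noncomputable section

/-- The product of two Vieta involutions fixing the coordinate `a`, acting on the other two. -/
def vietaPairStep {R : Type*} [CommRing R] (a : R) (v : R × R) : R × R :=
  (a * v.2 - v.1, a * (a * v.2 - v.1) - v.2)

/-- Binomial expansion of the iterates of `vietaPairStep a` to first order in `a ^ 2 - 4`. -/
theorem vietaPairStep_iterate {R : Type*} [CommRing R] (a y z : R) (n : ℕ) :
    ∃ r s : R, (vietaPairStep a)^[n] (y, z) =
      (y + (a ^ 2 - 4) * (n.choose 2 : ℕ) * y +
          (n + (a ^ 2 - 4) * ((n + 1).choose 3 : ℕ)) * (a * z - 2 * y) + (a ^ 2 - 4) ^ 2 * r,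
        z + (a ^ 2 - 4) * (n.choose 2 : ℕ) * z +
          (n + (a ^ 2 - 4) * ((n + 1).choose 3 : ℕ)) * ((a ^ 2 - 2) * z - a * y) +
            (a ^ 2 - 4) ^ 2 * s) := by
  induction n with
  | zero => exact ⟨0, 0, by simp [Nat.choose_eq_zero_of_lt]⟩
  | succ n ih =>
    obtain ⟨r, s, h⟩ := ih
    have h2 : (n + 1).choose 2 = n + n.choose 2 := by
      rw [Nat.choose_succ_succ' n 1, Nat.choose_one_right]
    have h3 : (n + 1 + 1).choose 3 = n + n.choose 2 + (n + 1).choose 3 := by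
      rw [Nat.choose_succ_succ' (n + 1) 2, h2]
    refine ⟨a * s - r + ((n + 1).choose 3 : ℕ) * (y + (a * z - 2 * y)),
      a * (a * s - r) - s + ((n + 1).choose 3 : ℕ) * (z + ((a ^ 2 - 2) * z - a * y)), ?_⟩
    rw [Function.iterate_succ_apply', h, h2, h3]
    simp only [vietaPairStep, Prod.mk.injEq]
    push_cast
    constructor <;> ring

theorem dvd_sq_sub_four_of_norm_le {p : ℕ} [Fact p.Prime] {a : ℤ_[p]}
    (h : ‖a - 2‖ ≤ (p : ℝ)⁻¹ ∨ ‖a + 2‖ ≤ (p : ℝ)⁻¹) : (p : ℤ_[p]) ∣ a ^ 2 - 4 := by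
  have key (b : ℤ_[p]) (hb : ‖b‖ ≤ (p : ℝ)⁻¹) : (p : ℤ_[p]) ∣ b := by
    have := (PadicInt.norm_le_pow_iff_mem_span_pow b 1).1 (by simpa using hb)
    simpa [Ideal.mem_span_singleton] using this
  rw [show a ^ 2 - 4 = (a - 2) * (a + 2) by ring]
  exact h.elim (fun h => (key _ h).mul_right _) (fun h => (key _ h).mul_left _)

theorem norm_vietaPairStep_iterate_prime {p : ℕ} [Fact p.Prime] (hp : 3 < p) {a y z : ℤ_[p]}
    (ha : ‖a - 2‖ ≤ (p : ℝ)⁻¹ ∨ ‖a + 2‖ ≤ (p : ℝ)⁻¹) (hu : IsUnit (2 * y - a * z)) :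
    ‖y - ((vietaPairStep a)^[p] (y, z)).1‖ = (p : ℝ)⁻¹ ∧
      ‖z - ((vietaPairStep a)^[p] (y, z)).2‖ ≤ (p : ℝ)⁻¹ := by
  have hP : p.Prime := Fact.out
  obtain ⟨e, he⟩ := dvd_sq_sub_four_of_norm_le ha
  obtain ⟨c, hc⟩ := hP.dvd_choose_self two_ne_zero (by lia)
  obtain ⟨d, hd⟩ : p ∣ (p + 1).choose 3 := by
    rw [Nat.choose_succ_succ' p 2]
    exact dvd_add (hP.dvd_choose_self two_ne_zero (by lia))
      (hP.dvd_choose_self three_ne_zero hp)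
  obtain ⟨r, s, h⟩ := vietaPairStep_iterate a y z p
  rw [h, he, hc, hd]
  push_cast
  constructor
  · rw [show y - (y + p * e * (p * c) * y + (p + p * e * (p * d)) * (a * z - 2 * y) +
        (p * e) ^ 2 * r) = p * ((2 * y - a * z) +
          p * (-(e * c * y + e * d * (a * z - 2 * y) + e ^ 2 * r))) by ring,
      norm_mul, PadicInt.norm_p]
    have h1 := PadicInt.isUnit_iff.1 hu
    set t := -(e * c * y + e * d * (a * z - 2 * y) + e ^ 2 * r)
    have h2 : ‖(p : ℤ_[p]) * t‖ < 1 := PadicInt.norm_lt_one_iff_dvd _ |>.2 (dvd_mul_right _ _)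
    rw [PadicInt.norm_add_eq_max_of_ne (by rw [h1]; exact h2.ne'), h1, max_eq_left h2.le, mul_one]
  · rw [show z - (z + p * e * (p * c) * z + (p + p * e * (p * d)) * ((a ^ 2 - 2) * z - a * y) +
        (p * e) ^ 2 * s) = p * (-(e * p * c * z + (1 + e * p * d) * ((a ^ 2 - 2) * z - a * y) +
          p * e ^ 2 * s)) by ring,
      norm_mul, PadicInt.norm_p]
    exact mul_le_of_le_one_right (by positivity) (PadicInt.norm_le_one _)

theorem vietaSz_mul_vietaSy_pow_apply {R : Type*} [CommRing R] (x y z : R) (n : ℕ) :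
    ((vietaSz R * vietaSy R) ^ n) (x, y, z) = (x, (vietaPairStep x)^[n] (y, z)) := by
  induction n with
  | zero => simp
  | succ n ih => rw [pow_succ', Equiv.Perm.mul_apply, ih, Function.iterate_succ_apply']; rfl

theorem vietaSz_mul_vietaSx_pow_apply {R : Type*} [CommRing R] (x y z : R) (n : ℕ) :
    ((vietaSz R * vietaSx R) ^ n) (x, y, z) =
      (((vietaPairStep y)^[n] (x, z)).1, y, ((vietaPairStep y)^[n] (x, z)).2) := by
  induction n with
  | zero => simp
  | succ n ih =>
    rw [pow_succ', Equiv.Perm.mul_apply, ih, Function.iterate_succ_apply']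
    simp [vietaSz, vietaSx, vietaPairStep, Function.Involutive.toPerm, mul_comm]

theorem vietaSy_mul_vietaSx_pow_apply {R : Type*} [CommRing R] (x y z : R) (n : ℕ) :
    ((vietaSy R * vietaSx R) ^ n) (x, y, z) =
      (((vietaPairStep z)^[n] (x, y)).1, ((vietaPairStep z)^[n] (x, y)).2, z) := by
  induction n with
  | zero => simp
  | succ n ih =>
    rw [pow_succ', Equiv.Perm.mul_apply, ih, Function.iterate_succ_apply']
    simp [vietaSy, vietaSx, vietaPairStep, Function.Involutive.toPerm, mul_comm]

/-- If `p > 3` is prime and `q = (x₀, y₀, z₀) ∈ X_D^*(ℤ_p)` has a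
coordinate congruent to `±2 (mod p)` and all three of `2x₀ - y₀z₀`, `2y₀ - x₀z₀`,
`2z₀ - x₀y₀` are units, then some element of the Vieta group moves `q` a distance
exactly `p⁻¹`. -/
theorem stmt17 (p : ℕ) [Fact p.Prime] (hp : 3 < p) (D : ℤ_[p]) (x₀ y₀ z₀ : ℤ_[p])
    (hq : (x₀, y₀, z₀) ∈ markoffSet ℤ_[p] D)
    (hcong : ‖x₀ - 2‖ ≤ ((p : ℝ))⁻¹ ∨ ‖x₀ + 2‖ ≤ ((p : ℝ))⁻¹ ∨
      ‖y₀ - 2‖ ≤ ((p : ℝ))⁻¹ ∨ ‖y₀ + 2‖ ≤ ((p : ℝ))⁻¹ ∨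
      ‖z₀ - 2‖ ≤ ((p : ℝ))⁻¹ ∨ ‖z₀ + 2‖ ≤ ((p : ℝ))⁻¹)
    (hux : IsUnit (2 * x₀ - y₀ * z₀)) (huy : IsUnit (2 * y₀ - x₀ * z₀))
    (huz : IsUnit (2 * z₀ - x₀ * y₀)) :
    ∃ γ ∈ vietaGroup ℤ_[p], dist (x₀, y₀, z₀) (γ (x₀, y₀, z₀)) = ((p : ℝ))⁻¹ := by
  have hx : vietaSx ℤ_[p] ∈ vietaGroup ℤ_[p] := Subgroup.subset_closure (by simp)
  have hy : vietaSy ℤ_[p] ∈ vietaGroup ℤ_[p] := Subgroup.subset_closure (by simp)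
  have hz : vietaSz ℤ_[p] ∈ vietaGroup ℤ_[p] := Subgroup.subset_closure (by simp)
  have hp0 : (0 : ℝ) ≤ (p : ℝ)⁻¹ := by positivity
  have hcases : (‖x₀ - 2‖ ≤ (p : ℝ)⁻¹ ∨ ‖x₀ + 2‖ ≤ (p : ℝ)⁻¹) ∨
      (‖y₀ - 2‖ ≤ (p : ℝ)⁻¹ ∨ ‖y₀ + 2‖ ≤ (p : ℝ)⁻¹) ∨
      (‖z₀ - 2‖ ≤ (p : ℝ)⁻¹ ∨ ‖z₀ + 2‖ ≤ (p : ℝ)⁻¹) := by tauto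
  rcases hcases with h | h | h
  · obtain ⟨h1, h2⟩ := norm_vietaPairStep_iterate_prime hp h huy
    refine ⟨_, pow_mem (mul_mem hz hy) p, ?_⟩
    rw [vietaSz_mul_vietaSy_pow_apply]
    simp only [Prod.dist_eq, dist_self]
    simp only [dist_eq_norm]
    rw [h1, max_eq_left h2, max_eq_right hp0]
  · obtain ⟨h1, h2⟩ := norm_vietaPairStep_iterate_prime hp h hux
    refine ⟨_, pow_mem (mul_mem hz hx) p, ?_⟩
    rw [vietaSz_mul_vietaSx_pow_apply]
    simp only [Prod.dist_eq, dist_self]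
    simp only [dist_eq_norm]
    rw [h1, max_eq_left (max_le hp0 h2)]
  · obtain ⟨h1, h2⟩ := norm_vietaPairStep_iterate_prime hp h
      (show IsUnit (2 * x₀ - z₀ * y₀) by rwa [mul_comm z₀])
    refine ⟨_, pow_mem (mul_mem hy hx) p, ?_⟩
    rw [vietaSy_mul_vietaSx_pow_apply]
    simp only [Prod.dist_eq, dist_self]
    simp only [dist_eq_norm]
    rw [h1, max_eq_left (max_le h2 hp0)]
end
end
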